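/- arXiv:1907.01603 — 2 statements merged into one kernel-verified Lean document; each statement's English description precedes it below -/
import Mathlib

section
/- For every integer s ≥ 4 and every even integer r with r ≥ 4·√(s-2), there exists n₀ = n₀(r,s) such that for all n ≥ n₀, every K_s-saturated graph on n vertices contains at least as many copies of C_r as the join K_{s-2} ∗ \bar{K}_{n-s+2}; moreover, if in addition r ≤ 2s - 4, then K_{s-2} ∗ \bar{K}_{n-s+2} is the unique n-vertex K_s-saturated graph attaining this minimum. -/
open SimpleGraph Finset

variable {V : Type*}

/-- The graph `G` with the edge `u v` added. -/
def addEdge (G : SimpleGraph V) (u v : V) : SimpleGraph V :=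
  G ⊔ SimpleGraph.fromEdgeSet {s(u, v)}

/-- `G` is `K_s`-saturated: `G` is `K_s`-free and adding any missing edge creates a `K_s`. -/
def KSat (s : ℕ) (G : SimpleGraph V) : Prop :=
  G.CliqueFree s ∧ ∀ u v : V, u ≠ v → ¬ G.Adj u v → ¬ (addEdge G u v).CliqueFree s

/-- The number of copies of `K_r` in `G`: the number of `r`-sets of vertices inducing
a complete graph. -/
noncomputable def cliqueCount (G : SimpleGraph V) (r : ℕ) : ℕ :=
  {t : Finset V | G.IsNClique r t}.ncard

/-- `sat(n, K_r, K_s)`: minimum number of copies of `K_r` in an `n`-vertex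
`K_s`-saturated graph. -/
noncomputable def satCliques (n r s : ℕ) : ℕ :=
  sInf {m | ∃ G : SimpleGraph (Fin n), KSat s G ∧ cliqueCount G r = m}

/-- The join `K_{s-2} ∗ ∅_{n-s+2}` on `Fin n`. -/
def joinGraph (n s : ℕ) : SimpleGraph (Fin n) :=
  SimpleGraph.fromRel (fun i _ => (i : ℕ) < s - 2)

/-- The number of copies of `C_r` in `G` : the number of subgraphs of `G`
isomorphic to the cycle on `r` vertices. -/
noncomputable def cycleCount (G : SimpleGraph V) (r : ℕ) : ℕ :=
  {H : G.Subgraph | Nonempty (H.coe ≃g cycleGraph r)}.ncard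

/-- `sat(n, C_r, K_s)`. -/
noncomputable def satCyclesCliqueSat (n r s : ℕ) : ℕ :=
  sInf {m | ∃ G : SimpleGraph (Fin n), KSat s G ∧ cycleCount G r = m}

/-- `G` contains a copy of `F`, i.e. a subgraph isomorphic to `F`. -/
def ContainsCopy {α β : Type*} (F : SimpleGraph α) (G : SimpleGraph β) : Prop :=
  ∃ f : α → β, Function.Injective f ∧ ∀ a b : α, F.Adj a b → G.Adj (f a) (f b)

/-- strongly K_s-saturated -/
def StronglyKSat (s : ℕ) (G : SimpleGraph V) : Prop :=
  ∀ u v : V, u ≠ v → ¬ G.Adj u v →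
    ∃ t : Finset V, (addEdge G u v).IsNClique s t ∧ u ∈ t ∧ v ∈ t

/-- dumbbell -/
def dumbbell (m : ℕ) : SimpleGraph (Fin (2 * m)) :=
  SimpleGraph.fromRel (fun i j =>
    ((i : ℕ) < m ∧ (j : ℕ) < m) ∨ (m ≤ (i : ℕ) ∧ m ≤ (j : ℕ)) ∨ ((i : ℕ) = 0 ∧ (j : ℕ) = m))

def Vgraph (m : ℕ) : SimpleGraph (Fin (m + 2)) :=
  SimpleGraph.fromRel (fun i j =>
    ((i : ℕ) < m ∧ (j : ℕ) < m) ∨ ((i : ℕ) = 0 ∧ m ≤ (j : ℕ)))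

def lambdaGraph (m : ℕ) : SimpleGraph (Fin (m + 1)) :=
  SimpleGraph.fromRel (fun i j =>
    ((i : ℕ) < m ∧ (j : ℕ) < m) ∨ ((i : ℕ) = m ∧ (j : ℕ) < 2))

def VgraphGen (m r : ℕ) : SimpleGraph (Fin (m + (m - r))) :=
  SimpleGraph.fromRel (fun i j =>
    ((i : ℕ) < m ∧ (j : ℕ) < m) ∨
      (((i : ℕ) = 0 ∨ m ≤ (i : ℕ)) ∧ ((j : ℕ) = 0 ∨ m ≤ (j : ℕ))))

def lambdaGraphGen (m r : ℕ) : SimpleGraph (Fin (m + 1)) :=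
  SimpleGraph.fromRel (fun i j =>
    ((i : ℕ) < m ∧ (j : ℕ) < m) ∨ ((i : ℕ) = m ∧ (j : ℕ) < r))

/-- `G` is saturated with respect to the family `{F₁, F₂, F₃}`. -/
def FamSat3 {α₁ α₂ α₃ : Type*} (F₁ : SimpleGraph α₁) (F₂ : SimpleGraph α₂)
    (F₃ : SimpleGraph α₃) (G : SimpleGraph V) : Prop :=
  ¬ ContainsCopy F₁ G ∧ ¬ ContainsCopy F₂ G ∧ ¬ ContainsCopy F₃ G ∧
    ∀ u v : V, u ≠ v → ¬ G.Adj u v →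
      ContainsCopy F₁ (addEdge G u v) ∨ ContainsCopy F₂ (addEdge G u v) ∨
        ContainsCopy F₃ (addEdge G u v)

noncomputable def satFam3 {α₁ α₂ α₃ : Type*} (n : ℕ) (F₁ : SimpleGraph α₁)
    (F₂ : SimpleGraph α₂) (F₃ : SimpleGraph α₃) : ℕ :=
  sInf {m | ∃ G : SimpleGraph (Fin n), FamSat3 F₁ F₂ F₃ G ∧ G.edgeSet.ncard = m}

noncomputable def satCliquesFam3 {α₁ α₂ α₃ : Type*} (n r : ℕ) (F₁ : SimpleGraph α₁)
    (F₂ : SimpleGraph α₂) (F₃ : SimpleGraph α₃) : ℕ :=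
  sInf {m | ∃ G : SimpleGraph (Fin n), FamSat3 F₁ F₂ F₃ G ∧ cliqueCount G r = m}

/-- saturation w.r.t. a single graph, with copies as subgraphs. -/
def SatGraph {α : Type*} (F : SimpleGraph α) (G : SimpleGraph V) : Prop :=
  ¬ ContainsCopy F G ∧ ∀ u v : V, u ≠ v → ¬ G.Adj u v → ContainsCopy F (addEdge G u v)

noncomputable def satCyclesGraphSat {α : Type*} (n r : ℕ) (F : SimpleGraph α) : ℕ :=
  sInf {m | ∃ G : SimpleGraph (Fin n), SatGraph F G ∧ cycleCount G r = m}

/-- number of independent sets of size l -/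
noncomputable def indepCount (G : SimpleGraph V) (l : ℕ) : ℕ :=
  {t : Finset V | t.card = l ∧ ∀ a ∈ t, ∀ b ∈ t, ¬ G.Adj a b}.ncard

/-- Ramsey number -/
noncomputable def ramsey (l s : ℕ) : ℕ :=
  sInf {N | ∀ G : SimpleGraph (Fin N),
    (∃ t : Finset (Fin N), t.card = l ∧ ∀ a ∈ t, ∀ b ∈ t, ¬ G.Adj a b) ∨
      ∃ t : Finset (Fin N), G.IsNClique s t}

section EvenCycles

open scoped Classical

/-- The injective choice functions of a finite family of finsets. -/
noncomputable def injChoices {k : ℕ} (T : Fin k → Finset V) : Finset (Fin k → V) :=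
  (Fintype.piFinset T).filter Function.Injective

lemma mem_injChoices {k : ℕ} {T : Fin k → Finset V} {w : Fin k → V} :
    w ∈ injChoices T ↔ (∀ i, w i ∈ T i) ∧ Function.Injective w := by
  simp [injChoices]

lemma card_injChoices_succ {k : ℕ} (T : Fin (k + 1) → Finset V) :
    #(injChoices T) = ∑ w ∈ injChoices (fun i : Fin k => T i.castSucc),
      #(T (Fin.last k) \ univ.image w) := by
  rw [← card_sigma]
  refine card_nbij' (fun w => ⟨Fin.init w, w (Fin.last k)⟩) (fun p => Fin.snoc p.1 p.2) ?_ ?_ ?_ ?_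
  · intro w hw
    have hw := mem_injChoices.1 (mem_coe.1 hw)
    simp only [coe_sigma, Set.mem_sigma_iff, mem_coe, mem_injChoices, mem_sdiff, mem_image,
      mem_univ, true_and, not_exists]
    refine ⟨⟨fun i => hw.1 _, fun i j h => ?_⟩, hw.1 _, fun i h => ?_⟩
    · exact Fin.castSucc_injective _ (hw.2 h)
    · exact Fin.castSucc_ne_last i (hw.2 h)
  · rintro ⟨w, x⟩ h
    simp only [coe_sigma, Set.mem_sigma_iff, mem_coe, mem_injChoices, mem_sdiff, mem_image,
      mem_univ, true_and, not_exists] at h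
    refine mem_coe.2 (mem_injChoices.2 ⟨fun i => ?_, ?_⟩)
    · refine Fin.lastCases ?_ (fun j => ?_) i
      · simpa using h.2.1
      · simpa using h.1.1 j
    · exact Fin.snoc_injective_of_injective h.1.2 (by rintro ⟨i, hi⟩; exact h.2.2 i hi)
  · intro w _
    simp
  · rintro ⟨w, x⟩ _
    simp

lemma le_card_sdiff_image {k c : ℕ} {A : Finset V} (w : Fin k → V) (hA : c ≤ #A) :
    c - k ≤ #(A \ univ.image w) := by
  have h1 : #(univ.image w) ≤ k := by simpa using card_image_le (s := univ) (f := w)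
  have h2 := le_card_sdiff (univ.image w) A
  omega

lemma mul_card_le_card_injChoices_succ {k c : ℕ} (T : Fin (k + 1) → Finset V)
    (hT : c ≤ #(T (Fin.last k))) :
    #(injChoices fun i : Fin k => T i.castSucc) * (c - k) ≤ #(injChoices T) := by
  rw [card_injChoices_succ, ← smul_eq_mul]
  exact card_nsmul_le_sum _ _ _ fun w _ => le_card_sdiff_image w hT

lemma prod_sub_le_card_injChoices {k : ℕ} (T : Fin k → Finset V) :
    ∏ i, (#(T i) - i) ≤ #(injChoices T) := by
  induction k with
  | zero =>
    have : (default : Fin 0 → V) ∈ injChoices T :=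
      mem_injChoices.2 ⟨fun i => i.elim0, fun i => i.elim0⟩
    simpa using card_pos.2 ⟨_, this⟩
  | succ k ih =>
    rw [Fin.prod_univ_castSucc]
    exact (Nat.mul_le_mul_right _ (ih fun i => T i.castSucc)).trans
      (mul_card_le_card_injChoices_succ T le_rfl)

lemma descFactorial_le_card_injChoices {k m : ℕ} (T : Fin k → Finset V)
    (hT : ∀ i, m ≤ #(T i)) : m.descFactorial k ≤ #(injChoices T) := by
  refine le_trans ?_ (prod_sub_le_card_injChoices T)
  rw [Nat.descFactorial_eq_prod_range, ← Fin.prod_univ_eq_prod_range (fun i => m - i)]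
  exact prod_le_prod' fun i _ => Nat.sub_le_sub_right (hT i) _

lemma card_injChoices_const {k : ℕ} (S : Finset V) :
    #(injChoices fun _ : Fin k => S) = (#S).descFactorial k := by
  induction k with
  | zero =>
    refine le_antisymm ?_ ?_
    · simpa [injChoices] using card_filter_le (Fintype.piFinset fun _ : Fin 0 => S) _
    · exact descFactorial_le_card_injChoices _ fun _ => le_rfl
  | succ k ih =>
    rw [card_injChoices_succ, Nat.descFactorial_succ, mul_comm, ← ih, ← smul_eq_mul]
    refine sum_const_nat fun w hw => ?_
    rw [mem_injChoices] at hw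
    rw [card_sdiff_of_subset (image_subset_iff.2 fun i _ => hw.1 i),
      card_image_of_injective _ hw.2]
    simp

/-- Choices from the private parts `P i` of a family of `m`-sets save conflicts. -/
lemma card_injChoices_private {k m : ℕ} (hk : k ≤ m) (T P : Fin k → Finset V)
    (hT : ∀ i, #(T i) = m) (hP : ∀ i, P i ⊆ T i) (hd : ∀ i j, i ≠ j → Disjoint (P i) (T j)) :
    m ^ k * m.descFactorial k + (∏ i, #(P i)) * m ^ k ≤
      m ^ k * #(injChoices T) + (∏ i, #(P i)) * m.descFactorial k := by
  induction k with
  | zero =>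
    have := prod_sub_le_card_injChoices T
    simp at this ⊢
    omega
  | succ k ih =>
    have ih := ih (by omega) (fun i => T i.castSucc) (fun i => P i.castSucc) (fun i => hT _)
      (fun i => hP _) (fun i j h => hd _ _ fun h' => h (Fin.castSucc_injective _ h'))
    set X := injChoices fun i : Fin k => T i.castSucc with hX
    set A := Fintype.piFinset fun i : Fin k => P i.castSucc with hA
    have hAcard : #A = ∏ i : Fin k, #(P i.castSucc) := by simp [hA]
    have hsub : A ⊆ X := fun w hw => by
      rw [hA, Fintype.mem_piFinset] at hw
      refine mem_injChoices.2 ⟨fun i => hP _ (hw i), fun i j h => ?_⟩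
      by_contra hij
      have := hd i.castSucc j.castSucc fun h' => hij (Fin.castSucc_injective _ h')
      exact disjoint_left.1 this (hw i) (h ▸ hP _ (hw j))
    have hstep : #X * (m - k) + #A * k ≤ #(injChoices T) := by
      have h1 : #A * m ≤ ∑ w ∈ A, #(T (Fin.last k) \ univ.image w) := by
        rw [← smul_eq_mul]
        refine card_nsmul_le_sum _ _ _ fun w hw => ?_
        rw [hA, Fintype.mem_piFinset] at hw
        rw [sdiff_eq_self_of_disjoint, hT]
        rw [disjoint_right]
        intro x hx hx'
        obtain ⟨i, -, rfl⟩ := mem_image.1 hx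
        exact disjoint_left.1 (hd _ _ (Fin.castSucc_ne_last i)) (hw i) hx'
      have h2 : #(X \ A) * (m - k) ≤ ∑ w ∈ X \ A, #(T (Fin.last k) \ univ.image w) := by
        rw [← smul_eq_mul]
        exact card_nsmul_le_sum _ _ _ fun w _ => le_card_sdiff_image w (hT _).ge
      have h3 : #(X \ A) + #A = #X := card_sdiff_add_card_eq_card hsub
      rw [card_injChoices_succ, ← sum_sdiff hsub, ← h3]
      have h4 : #A * m = #A * (m - k) + #A * k := by
        rw [← mul_add, Nat.sub_add_cancel (by omega)]
      rw [add_mul]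
      omega
    rw [Fin.prod_univ_castSucc, ← hAcard]
    rw [← hAcard] at ih
    obtain ⟨d, rfl⟩ : ∃ d, m = k + d := ⟨m - k, by omega⟩
    have hp : #(P (Fin.last k)) ≤ k + d := (card_le_card (hP _)).trans (hT _).le
    have hq : (k + d).descFactorial k ≤ (k + d) ^ k := Nat.descFactorial_le_pow _ _
    rw [Nat.descFactorial_succ, pow_succ]
    simp only [Nat.add_sub_cancel_left] at hstep ⊢
    generalize (k + d).descFactorial k = q at *
    generalize (k + d) ^ k = Q at *
    generalize #(P (Fin.last k)) = p at *
    generalize #A = a at *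
    generalize #X = x at *
    generalize #(injChoices T) = y at *
    have e1 : Q * (k + d) * (x * d + a * k) ≤ Q * (k + d) * y := Nat.mul_le_mul_left _ hstep
    have e2 := Nat.mul_le_mul_left ((k + d) * d) ih
    have e3 : a * p * ((k + d) * Q - d * q) ≤ a * (k + d) * ((k + d) * Q - d * q) :=
      Nat.mul_le_mul_right _ (Nat.mul_le_mul_left _ hp)
    have e4 : d * q ≤ (k + d) * Q := Nat.mul_le_mul (by omega) hq
    zify [e4] at *
    nlinarith

lemma descFactorial_lt_card_injChoices {t m : ℕ} (ht : t + 2 ≤ m) (T : Fin (t + 2) → Finset V)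
    (hT : ∀ i, #(T i) = m) (h01 : T 0 ≠ T 1) :
    m.descFactorial (t + 2) < #(injChoices T) := by
  induction t with
  | zero =>
    have hns : ¬ T 0 ⊆ T 1 := fun h => h01 (eq_of_subset_of_card_le h (by rw [hT, hT]))
    obtain ⟨x, hx0, hx1⟩ := not_subset.1 hns
    rw [card_injChoices_succ, Nat.descFactorial_succ, mul_comm]
    have hc : m.descFactorial 1 = #(injChoices fun i : Fin 1 => T i.castSucc) := by
      rw [← hT 0, ← card_injChoices_const]
      congr 2
      funext i
      rw [Subsingleton.elim i 0]
      rfl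
    rw [hc, ← smul_eq_mul, ← sum_const]
    refine sum_lt_sum (fun w _ => le_card_sdiff_image w (hT _).ge) ⟨fun _ => x, ?_, ?_⟩
    · refine mem_injChoices.2 ⟨fun i => ?_, Function.injective_of_subsingleton _⟩
      rw [Subsingleton.elim i 0]
      exact hx0
    · rw [sdiff_eq_self_of_disjoint, hT]
      · omega
      · refine disjoint_right.2 fun y hy => ?_
        obtain ⟨i, -, rfl⟩ := mem_image.1 hy
        exact hx1
  | succ t ih =>
    have ih := ih (by omega) (fun i => T i.castSucc) (fun i => hT _) h01
    have h := mul_card_le_card_injChoices_succ T (hT _).ge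
    rw [Nat.descFactorial_succ, mul_comm]
    refine lt_of_lt_of_le ?_ h
    exact Nat.mul_lt_mul_of_pos_right ih (by omega)

lemma two_mul_descFactorial_lt {k m : ℕ} (hk : 3 ≤ k) (hkm : k ≤ m) (h : 4 * m ≤ k ^ 2) :
    2 * m.descFactorial k < m ^ k := by
  have key : ∀ j, j ≤ m → m.descFactorial j * (2 * m + j * (j - 1)) ≤ 2 * m * m ^ j := by
    intro j hj
    induction j with
    | zero => simp
    | succ j ih =>
      have ih := ih (by omega)
      rw [Nat.descFactorial_succ, pow_succ, Nat.add_sub_cancel]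
      have h1 : (m - j) * (2 * m + (j + 1) * j) ≤ m * (2 * m + j * (j - 1)) := by
        obtain ⟨d, rfl⟩ : ∃ d, m = j + d := ⟨m - j, by omega⟩
        rw [Nat.add_sub_cancel_left]
        rcases j with _ | j
        · simp
        · simp only [Nat.add_sub_cancel]
          nlinarith [Nat.zero_le (j * j * d), Nat.zero_le (j * j * j), Nat.zero_le (j * d)]
      calc (m - j) * m.descFactorial j * (2 * m + (j + 1) * j)
          = m.descFactorial j * ((m - j) * (2 * m + (j + 1) * j)) := by ring
        _ ≤ m.descFactorial j * (m * (2 * m + j * (j - 1))) := Nat.mul_le_mul_left _ h1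
        _ = m * (m.descFactorial j * (2 * m + j * (j - 1))) := by ring
        _ ≤ m * (2 * m * m ^ j) := Nat.mul_le_mul_left _ ih
        _ = 2 * m * (m ^ j * m) := by ring
  have h1 := key k hkm
  have hM : 0 < m.descFactorial k := Nat.descFactorial_pos.2 hkm
  have h2 : 2 * m < k * (k - 1) := by
    obtain ⟨d, rfl⟩ : ∃ d, k = d + 3 := ⟨k - 3, by omega⟩
    rw [show d + 3 - 1 = d + 2 by omega]
    nlinarith
  have h3 : m.descFactorial k * (4 * m) < 2 * m * m ^ k :=
    lt_of_lt_of_le (Nat.mul_lt_mul_of_pos_left (by omega) hM) h1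
  by_contra! hcon
  have := Nat.mul_le_mul_left (2 * m) hcon
  nlinarith

/-- Labelled copies of the cycle of length `2 * k`, listed as the pair of their two alternating
vertex sequences. -/
noncomputable def altCycles [Fintype V] (G : SimpleGraph V) (k : ℕ) [NeZero k] :
    Finset ((Fin k → V) × (Fin k → V)) :=
  univ.filter fun p => Function.Injective p.1 ∧ Function.Injective p.2 ∧
    (∀ i j, p.1 i ≠ p.2 j) ∧ (∀ i, G.Adj (p.1 i) (p.2 i)) ∧ ∀ i, G.Adj (p.2 i) (p.1 (i + 1))

lemma mem_altCycles [Fintype V] {G : SimpleGraph V} {k : ℕ} [NeZero k]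
    {p : (Fin k → V) × (Fin k → V)} :
    p ∈ altCycles G k ↔ Function.Injective p.1 ∧ Function.Injective p.2 ∧
      (∀ i j, p.1 i ≠ p.2 j) ∧ (∀ i, G.Adj (p.1 i) (p.2 i)) ∧
      ∀ i, G.Adj (p.2 i) (p.1 (i + 1)) := by
  simp [altCycles]

/-- `S` selects an `m`-clique in the common neighbourhood of every pair of distinct nonadjacent
vertices. -/
def IsSelection (G : SimpleGraph V) (m : ℕ) (S : V → V → Finset V) : Prop :=
  ∀ u v, u ≠ v → ¬ G.Adj u v →
    #(S u v) = m ∧ G.IsClique (S u v) ∧ ∀ y ∈ S u v, G.Adj u y ∧ G.Adj y v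

/-- Injective tuples of pairwise nonadjacent vertices. -/
noncomputable def indepTuples [Fintype V] (G : SimpleGraph V) (k : ℕ) : Finset (Fin k → V) :=
  univ.filter fun v => Function.Injective v ∧ ∀ i j, ¬ G.Adj (v i) (v j)

lemma mem_indepTuples [Fintype V] {G : SimpleGraph V} {k : ℕ} {v : Fin k → V} :
    v ∈ indepTuples G k ↔ Function.Injective v ∧ ∀ i j, ¬ G.Adj (v i) (v j) := by
  simp [indepTuples]

/-- The cliques selected along a cyclic sequence of vertices. -/
def selAlong {k : ℕ} [NeZero k] (S : V → V → Finset V) (v : Fin k → V) (i : Fin k) : Finset V :=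
  S (v i) (v (i + 1))

/-- Injective choices consisting of pairwise nonadjacent vertices. -/
noncomputable def indepChoices {k : ℕ} (G : SimpleGraph V) (T : Fin k → Finset V) :
    Finset (Fin k → V) :=
  (injChoices T).filter fun w => ∀ i j, ¬ G.Adj (w i) (w j)

lemma exists_private_card {k : ℕ} (G : SimpleGraph V) (T : Fin k → Finset V)
    (hc : ∀ i, G.IsClique (T i)) :
    ∃ P : Fin k → Finset V, (∀ i, P i ⊆ T i) ∧ (∀ i j, i ≠ j → Disjoint (P i) (T j)) ∧
      #(indepChoices G T) ≤ ∏ i, #(P i) := by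
  refine ⟨fun i => (T i).filter fun x => ∀ j, j ≠ i → x ∉ T j, fun i => filter_subset _ _,
    fun i j hij => disjoint_left.2 fun x hx => (mem_filter.1 hx).2 j hij.symm, ?_⟩
  rw [← Fintype.card_piFinset]
  refine card_le_card fun w hw => ?_
  rw [indepChoices, mem_filter, mem_injChoices] at hw
  refine Fintype.mem_piFinset.2 fun i => mem_filter.2 ⟨hw.1.1 i, fun j hj hx => ?_⟩
  exact hw.2 i j (hc j hx (hw.1.1 j) fun h => hj (hw.1.2 h).symm)

lemma two_mul_descFactorial_add_card_le {k m : ℕ} (hk : k ≤ m)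
    (hm : 2 * m.descFactorial k < m ^ k) (G : SimpleGraph V) (T : Fin k → Finset V)
    (hT : ∀ i, #(T i) = m) (hc : ∀ i, G.IsClique (T i)) :
    2 * m.descFactorial k + #(indepChoices G T) ≤ 2 * #(injChoices T) := by
  obtain ⟨P, hP, hd, hI⟩ := exists_private_card G T hc
  have h := card_injChoices_private hk T P hT hP hd
  refine le_trans (Nat.add_le_add_left hI _) ?_
  generalize ∏ i, #(P i) = a at *
  generalize #(injChoices T) = x at *
  generalize m.descFactorial k = M at *
  generalize m ^ k = Q at *
  have hQ : 0 < Q := by omega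
  refine Nat.le_of_mul_le_mul_left ?_ hQ
  nlinarith [Nat.mul_le_mul_left a hm.le]

lemma two_mul_descFactorial_add_card_lt {t m : ℕ} (hk : t + 3 ≤ m)
    (hm : 2 * m.descFactorial (t + 3) < m ^ (t + 3)) (G : SimpleGraph V)
    (T : Fin (t + 3) → Finset V) (hT : ∀ i, #(T i) = m) (hc : ∀ i, G.IsClique (T i))
    (h01 : T 0 ≠ T 1) :
    2 * m.descFactorial (t + 3) + #(indepChoices G T) + 1 ≤ 2 * #(injChoices T) := by
  obtain ⟨P, hP, hd, hI⟩ := exists_private_card G T hc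
  have h := card_injChoices_private hk T P hT hP hd
  have h' : m.descFactorial (t + 3) < #(injChoices T) :=
    descFactorial_lt_card_injChoices hk T hT h01
  rcases Nat.eq_zero_or_pos (∏ i, #(P i)) with h0 | h0
  · omega
  refine Nat.succ_le_of_lt (lt_of_le_of_lt (Nat.add_le_add_left hI _) ?_)
  generalize ∏ i, #(P i) = a at *
  generalize #(injChoices T) = x at *
  generalize m.descFactorial (t + 3) = M at *
  generalize m ^ (t + 3) = Q at *
  have hQ : 0 < Q := by omega
  refine Nat.lt_of_mul_lt_mul_left (a := Q) ?_
  nlinarith [Nat.mul_lt_mul_of_pos_left hm h0]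

lemma ne_add_one_fin {t : ℕ} (i : Fin (t + 2)) : i ≠ i + 1 := by
  intro h
  have : (1 : Fin (t + 2)) = 0 := by
    simpa using h.symm
  simp at this

lemma mem_altCycles_of_mem_injChoices [Fintype V] {G : SimpleGraph V} {t m : ℕ}
    {S : V → V → Finset V} (hS : IsSelection G m S) {v w : Fin (t + 3) → V}
    (hv : v ∈ indepTuples G (t + 3)) (hw : w ∈ injChoices (selAlong S v)) :
    (v, w) ∈ altCycles G (t + 3) := by
  rw [mem_indepTuples] at hv
  rw [mem_injChoices] at hw
  have hadj : ∀ i, G.Adj (v i) (w i) ∧ G.Adj (w i) (v (i + 1)) := fun i =>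
    (hS _ _ (fun h => ne_add_one_fin i (hv.1 h)) (hv.2 _ _)).2.2 _ (hw.1 i)
  refine mem_altCycles.2 ⟨hv.1, hw.2, fun i j h => ?_, fun i => (hadj i).1, fun i => (hadj i).2⟩
  have h : v i = w j := h
  exact hv.2 j i (h ▸ (hadj j).1)

lemma shift_mem_altCycles [Fintype V] {G : SimpleGraph V} {k : ℕ} [NeZero k]
    {v w : Fin k → V} (h : (v, w) ∈ altCycles G k) :
    (w, fun i => v (i + 1)) ∈ altCycles G k := by
  obtain ⟨h1, h2, h3, h4, h5⟩ := mem_altCycles.1 h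
  exact mem_altCycles.2 ⟨h2, fun i j hij => add_right_cancel (h1 hij), fun i j => (h3 _ _).symm,
    h5, fun i => h4 _⟩

lemma two_mul_sum_card_injChoices_le [Fintype V] {G : SimpleGraph V} {t m : ℕ}
    {S : V → V → Finset V} (hS : IsSelection G m S) :
    2 * ∑ v ∈ indepTuples G (t + 3), #(injChoices (selAlong S v)) ≤
      #(altCycles G (t + 3)) +
        ∑ v ∈ indepTuples G (t + 3), #(indepChoices G (selAlong S v)) := by
  set D := (indepTuples G (t + 3)).sigma fun v => injChoices (selAlong S v) with hD
  set I := (indepTuples G (t + 3)).sigma fun v => indepChoices G (selAlong S v) with hI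
  let f₁ : (Σ _ : Fin (t + 3) → V, Fin (t + 3) → V) → (Fin (t + 3) → V) × (Fin (t + 3) → V) :=
    fun x => (x.1, x.2)
  let f₂ : (Σ _ : Fin (t + 3) → V, Fin (t + 3) → V) → (Fin (t + 3) → V) × (Fin (t + 3) → V) :=
    fun x => (x.2, fun i => x.1 (i + 1))
  have hf₁ : Function.Injective f₁ := by
    rintro ⟨a, b⟩ ⟨c, d⟩ h
    simp only [f₁, Prod.mk.injEq] at h
    rw [h.1, h.2]
  have hf₂ : Function.Injective f₂ := by
    rintro ⟨a, b⟩ ⟨c, d⟩ h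
    simp only [f₂, Prod.mk.injEq] at h
    have : a = c := by
      funext i
      simpa using congrFun h.2 (i - 1)
    rw [h.1, this]
  have hmem : ∀ x ∈ D, f₁ x ∈ altCycles G (t + 3) := fun x hx => by
    rw [hD, mem_sigma] at hx
    exact mem_altCycles_of_mem_injChoices hS hx.1 hx.2
  have hunion : D.image f₁ ∪ D.image f₂ ⊆ altCycles G (t + 3) := by
    refine union_subset (image_subset_iff.2 hmem) (image_subset_iff.2 fun x hx => ?_)
    exact shift_mem_altCycles (hmem x hx)
  have hinter : D.image f₁ ∩ D.image f₂ ⊆ I.image f₁ := by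
    intro p hp
    obtain ⟨hp1, hp2⟩ := mem_inter.1 hp
    obtain ⟨x, hx, rfl⟩ := mem_image.1 hp1
    obtain ⟨y, hy, hxy⟩ := mem_image.1 hp2
    refine mem_image_of_mem _ ?_
    rw [hD, mem_sigma] at hx hy
    rw [hI, mem_sigma]
    refine ⟨hx.1, mem_filter.2 ⟨hx.2, fun i j => ?_⟩⟩
    have h2 : (fun i => y.1 (i + 1)) = x.2 := congrArg Prod.snd hxy
    rw [← h2]
    exact (mem_indepTuples.1 hy.1).2 _ _
  have h1 := card_union_add_card_inter (D.image f₁) (D.image f₂)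
  rw [card_image_of_injective _ hf₁, card_image_of_injective _ hf₂] at h1
  have h2 := card_le_card hunion
  have h3 := card_le_card hinter
  rw [card_image_of_injective _ hf₁] at h3
  rw [← card_sigma, ← card_sigma, ← hD, ← hI]
  omega

/-- Every independent cyclic tuple accounts for at least `2 * m.descFactorial k` labelled cycles,
and for one more when its first two selected cliques differ. -/
lemma card_altCycles_ge_of_selection [Fintype V] {G : SimpleGraph V} {t m : ℕ}
    {S : V → V → Finset V} (hS : IsSelection G m S) (hk : t + 3 ≤ m)
    (hm : 2 * m.descFactorial (t + 3) < m ^ (t + 3)) :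
    2 * m.descFactorial (t + 3) * #(indepTuples G (t + 3)) +
      #((indepTuples G (t + 3)).filter fun v => S (v 0) (v 1) ≠ S (v 1) (v 2)) ≤
      #(altCycles G (t + 3)) := by
  have h := two_mul_sum_card_injChoices_le (t := t) hS
  have hsel : ∀ v ∈ indepTuples G (t + 3), ∀ i, #(selAlong S v i) = m ∧
      G.IsClique (selAlong S v i : Set V) := fun v hv i => by
    rw [mem_indepTuples] at hv
    have := hS (v i) (v (i + 1)) (fun h => ne_add_one_fin i (hv.1 h)) (hv.2 _ _)
    exact ⟨this.1, this.2.1⟩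
  have hsum : ∑ v ∈ indepTuples G (t + 3), (2 * m.descFactorial (t + 3) +
      #(indepChoices G (selAlong S v)) + if S (v 0) (v 1) ≠ S (v 1) (v 2) then 1 else 0) ≤
      ∑ v ∈ indepTuples G (t + 3), 2 * #(injChoices (selAlong S v)) := by
    refine sum_le_sum fun v hv => ?_
    split_ifs with h01
    · refine two_mul_descFactorial_add_card_lt hk hm G _ (fun i => (hsel v hv i).1)
        (fun i => (hsel v hv i).2) ?_
      have h12 : (1 : Fin (t + 3)) + 1 = 2 := by
        ext
        simp [Fin.val_add]
      simpa [selAlong, h12] using h01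
    · exact two_mul_descFactorial_add_card_le hk hm G _ (fun i => (hsel v hv i).1)
        (fun i => (hsel v hv i).2)
  rw [sum_add_distrib, sum_add_distrib, sum_const, smul_eq_mul, ← card_filter, ← mul_sum] at hsum
  rw [mul_comm]
  omega

lemma card_filter_rel_le [Fintype V] {k : ℕ} (r : V → V → Prop) {i j : Fin (k + 2)}
    (hij : i ≠ j) :
    #(univ.filter fun v : Fin (k + 2) → V => r (v i) (v j)) ≤
      #(univ.filter fun p : V × V => r p.1 p.2) * Fintype.card V ^ k := by
  have hc : #(univ : Finset ({l : Fin (k + 2) // l ∉ ({i, j} : Finset (Fin (k + 2)))} → V)) =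
      Fintype.card V ^ k := by
    rw [card_univ, Fintype.card_fun, Fintype.card_subtype]
    congr 1
    rw [filter_not, filter_mem_eq_inter, univ_inter, card_sdiff_of_subset (subset_univ _),
      card_pair hij]
    simp
  rw [← hc, ← card_product]
  refine card_le_card_of_injOn (fun v => ((v i, v j), fun l => v l.1)) ?_ ?_
  · intro v hv
    simpa using hv
  · intro v _ v' _ h
    simp only [Prod.mk.injEq] at h
    funext l
    by_cases hl : l ∈ ({i, j} : Finset (Fin (k + 2)))
    · rcases mem_insert.1 hl with rfl | hl
      · exact h.1.1
      · rw [mem_singleton.1 hl]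
        exact h.1.2
    · exact congrFun h.2 ⟨l, hl⟩

lemma card_exists_rel_le [Fintype V] {k : ℕ} (r : V → V → Prop) :
    #(univ.filter fun v : Fin (k + 2) → V => ∃ i j, i ≠ j ∧ r (v i) (v j)) ≤
      (k + 2) ^ 2 * (#(univ.filter fun p : V × V => r p.1 p.2) * Fintype.card V ^ k) := by
  have hsub : (univ.filter fun v : Fin (k + 2) → V => ∃ i j, i ≠ j ∧ r (v i) (v j)) ⊆
      ((univ : Finset (Fin (k + 2) × Fin (k + 2))).filter fun q => q.1 ≠ q.2).biUnion
        fun q => univ.filter fun v : Fin (k + 2) → V => r (v q.1) (v q.2) := by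
    intro v hv
    obtain ⟨i, j, hij, h⟩ := (mem_filter.1 hv).2
    exact mem_biUnion.2 ⟨(i, j), by simpa using hij, by simpa using h⟩
  refine (card_le_card hsub).trans ((card_biUnion_le_card_mul _ _ _ fun q hq =>
    card_filter_rel_le r (mem_filter.1 hq).2).trans (Nat.mul_le_mul_right _ ?_))
  refine (card_filter_le _ _).trans ?_
  simp [sq]

/-- Number of ordered adjacent pairs. -/
noncomputable def adjPairs [Fintype V] (G : SimpleGraph V) : ℕ :=
  #(univ.filter fun p : V × V => G.Adj p.1 p.2)

lemma pow_le_card_indepTuples_add [Fintype V] (G : SimpleGraph V) (k : ℕ) :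
    Fintype.card V ^ (k + 2) ≤ #(indepTuples G (k + 2)) +
      (k + 2) ^ 2 * ((Fintype.card V + adjPairs G) * Fintype.card V ^ k) := by
  obtain ⟨r, hr⟩ : ∃ r : V → V → Prop, ∀ u v, r u v ↔ u = v ∨ G.Adj u v :=
    ⟨_, fun _ _ => Iff.rfl⟩
  have h := card_exists_rel_le (k := k) r
  have h2 : #(univ.filter fun p : V × V => r p.1 p.2) ≤ Fintype.card V + adjPairs G := by
    simp only [hr]
    rw [filter_or]
    refine (card_union_le _ _).trans (Nat.add_le_add_right ?_ _)
    rw [← card_univ]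
    refine card_le_card_of_injOn Prod.fst (fun _ _ => by simp) ?_
    rintro ⟨a, b⟩ hp ⟨c, d⟩ hq h
    simp at hp hq h
    simp_all
  have h3 : Fintype.card V ^ (k + 2) = #(univ : Finset (Fin (k + 2) → V)) := by simp
  rw [h3, ← card_filter_add_card_filter_not (s := univ) fun v => v ∈ indepTuples G (k + 2),
    filter_mem_eq_inter, univ_inter]
  refine Nat.add_le_add_left (le_trans (card_le_card fun v hv => ?_) (h.trans
    (Nat.mul_le_mul_left _ (Nat.mul_le_mul_right _ h2)))) _
  rw [mem_filter, mem_indepTuples] at hv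
  refine mem_filter.2 ⟨mem_univ _, ?_⟩
  by_contra! hcon
  simp only [hr, not_or] at hcon
  refine hv.2 ⟨fun i j hij => ?_, fun i j hadj => ?_⟩
  · by_contra hne
    exact (hcon i j hne).1 hij
  · exact (hcon i j fun h => G.irrefl (h ▸ hadj)).2 hadj

lemma sum_card_common_eq [Fintype V] (G : SimpleGraph V) (k : ℕ) :
    ∑ v : Fin k → V, #(univ.filter fun y => ∀ i, G.Adj (v i) y) =
      ∑ y, #(univ.filter fun x => G.Adj x y) ^ k := by
  simp_rw [card_filter]
  rw [sum_comm]
  refine sum_congr rfl fun y _ => ?_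
  rw [← card_filter, ← card_filter]
  rw [show #(univ.filter fun x => G.Adj x y) ^ k =
    ∏ _i : Fin k, #(univ.filter fun x => G.Adj x y) by simp, ← Fintype.card_piFinset]
  congr 1
  ext v
  simp [Fintype.mem_piFinset]

lemma sum_card_filter_adj_eq [Fintype V] (G : SimpleGraph V) :
    ∑ y, #(univ.filter fun x => G.Adj x y) = adjPairs G := by
  rw [adjPairs, card_filter, Fintype.sum_prod_type_right]
  simp_rw [card_filter]

lemma card_not_injective_le [Fintype V] (k : ℕ) :
    #(univ.filter fun v : Fin (k + 2) → V => ¬ Function.Injective v) ≤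
      (k + 2) ^ 2 * Fintype.card V ^ (k + 1) := by
  have h := card_exists_rel_le (k := k) fun u v : V => u = v
  have h2 : #(univ.filter fun p : V × V => p.1 = p.2) = Fintype.card V := by
    rw [← card_univ]
    refine card_nbij' Prod.fst (fun a => (a, a)) ?_ ?_ ?_ ?_ <;> simp +contextual [Set.MapsTo, Set.LeftInvOn]
  rw [h2, ← pow_succ'] at h
  refine le_trans (card_le_card fun v hv => ?_) h
  have hv := (mem_filter.1 hv).2
  refine mem_filter.2 ⟨mem_univ _, ?_⟩
  simp only [Function.Injective, not_forall] at hv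
  obtain ⟨i, j, hij, hne⟩ := hv
  exact ⟨i, j, hne, hij⟩

lemma sum_card_common_pow_le [Fintype V] (G : SimpleGraph V) (k : ℕ) :
    ∑ v : Fin (k + 2) → V, #(univ.filter fun y => ∀ i, G.Adj (v i) y) ^ (k + 2) ≤
      #(altCycles G (k + 2)) + 2 * (k + 2) ^ 2 * Fintype.card V ^ (2 * k + 3) := by
  set D := (univ : Finset (Fin (k + 2) → V)).sigma fun v =>
    Fintype.piFinset fun _ : Fin (k + 2) => univ.filter fun y => ∀ i, G.Adj (v i) y with hD
  have hDc : #D = ∑ v : Fin (k + 2) → V,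
      #(univ.filter fun y => ∀ i, G.Adj (v i) y) ^ (k + 2) := by
    simp [hD, card_sigma]
  set N := univ.filter fun v : Fin (k + 2) → V => ¬ Function.Injective v with hN
  have hNc : #N ≤ (k + 2) ^ 2 * Fintype.card V ^ (k + 1) := card_not_injective_le k
  have hle : #D ≤ #(altCycles G (k + 2) ∪ (N ×ˢ univ ∪ univ ×ˢ N)) := by
    refine card_le_card_of_injOn (fun x => (x.1, x.2)) ?_ ?_
    · rintro ⟨v, w⟩ hx
      rw [mem_coe, hD, mem_sigma] at hx
      have hadj : ∀ i j, G.Adj (v j) (w i) := fun i =>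
        (mem_filter.1 (Fintype.mem_piFinset.1 hx.2 i)).2
      simp only [coe_union, Set.mem_union, mem_coe, mem_product, mem_univ, and_true, true_and]
      by_cases hv : Function.Injective v
      · by_cases hw : Function.Injective w
        · refine Or.inl (mem_altCycles.2 ⟨hv, hw, fun i j h => ?_, fun i => hadj _ _,
            fun i => (hadj _ _).symm⟩)
          exact (hadj j i).ne h
        · exact Or.inr (Or.inr (by simpa [hN] using hw))
      · exact Or.inr (Or.inl (by simpa [hN] using hv))
    · rintro ⟨a, b⟩ _ ⟨c, d⟩ _ h
      simp only [Prod.mk.injEq] at h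
      rw [h.1, h.2]
  rw [← hDc]
  refine hle.trans ((card_union_le _ _).trans (Nat.add_le_add_left ((card_union_le _ _).trans ?_) _))
  rw [card_product, card_product]
  have hu : #(univ : Finset (Fin (k + 2) → V)) = Fintype.card V ^ (k + 2) := by simp
  rw [hu]
  calc #N * Fintype.card V ^ (k + 2) + Fintype.card V ^ (k + 2) * #N
      = 2 * (#N * Fintype.card V ^ (k + 2)) := by ring
    _ ≤ 2 * ((k + 2) ^ 2 * Fintype.card V ^ (k + 1) * Fintype.card V ^ (k + 2)) := by gcongr
    _ = 2 * (k + 2) ^ 2 * Fintype.card V ^ (2 * k + 3) := by ring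

/-- Dense graphs contain a positive proportion of all possible cycles of a given even length. -/
lemma le_card_altCycles_of_dense [Fintype V] (G : SimpleGraph V) (k : ℕ) {c : ℝ} (hc : 0 ≤ c)
    (hn : 0 < Fintype.card V) (h : c * (Fintype.card V : ℝ) ^ 2 ≤ adjPairs G) :
    c ^ ((k + 2) * (k + 2)) * (Fintype.card V : ℝ) ^ (2 * k + 4) ≤
      #(altCycles G (k + 2)) + 2 * ((k : ℝ) + 2) ^ 2 * (Fintype.card V : ℝ) ^ (2 * k + 3) := by
  have h0 : ((∑ v : Fin (k + 2) → V, #(univ.filter fun y => ∀ i, G.Adj (v i) y) ^ (k + 2) : ℕ) : ℝ)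
      ≤ #(altCycles G (k + 2)) + 2 * ((k : ℝ) + 2) ^ 2 * (Fintype.card V : ℝ) ^ (2 * k + 3) := by
    exact_mod_cast sum_card_common_pow_le G k
  refine le_trans ?_ h0
  set n : ℝ := (Fintype.card V : ℝ) with hndef
  have hn0 : 0 < n := Nat.cast_pos.2 hn
  have e1 := pow_sum_div_card_le_sum_pow (s := (univ : Finset V))
    (f := fun y => (#(univ.filter fun x => G.Adj x y) : ℝ)) (fun _ _ => by positivity) (k + 1)
  have e2 := pow_sum_div_card_le_sum_pow (s := (univ : Finset (Fin (k + 2) → V)))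
    (f := fun v => (#(univ.filter fun y => ∀ i, G.Adj (v i) y) : ℝ)) (fun _ _ => by positivity)
    (k + 1)
  have s1 : ∑ y, (#(univ.filter fun x => G.Adj x y) : ℝ) = adjPairs G := by
    exact_mod_cast sum_card_filter_adj_eq G
  have s2 : ∑ v : Fin (k + 2) → V, (#(univ.filter fun y => ∀ i, G.Adj (v i) y) : ℝ) =
      ∑ y, (#(univ.filter fun x => G.Adj x y) : ℝ) ^ (k + 1 + 1) := by
    exact_mod_cast sum_card_common_eq G (k + 2)
  have hu : (#(univ : Finset (Fin (k + 2) → V)) : ℝ) = n ^ (k + 2) := by simp [hndef]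
  rw [s1, card_univ, ← hndef] at e1
  rw [s2, hu] at e2
  push_cast
  refine le_trans ?_ e2
  rw [le_div_iff₀ (by positivity)]
  have e3 : c ^ (k + 2) * n ^ (k + 3) ≤ ∑ y, (#(univ.filter fun x => G.Adj x y) : ℝ) ^ (k + 1 + 1) := by
    refine le_trans ?_ e1
    rw [le_div_iff₀ (by positivity)]
    calc c ^ (k + 2) * n ^ (k + 3) * n ^ (k + 1) = (c * n ^ 2) ^ (k + 1 + 1) := by ring
      _ ≤ _ := by gcongr
  calc c ^ ((k + 2) * (k + 2)) * n ^ (2 * k + 4) * (n ^ (k + 2)) ^ (k + 1)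
      = (c ^ (k + 2) * n ^ (k + 3)) ^ (k + 1 + 1) := by ring
    _ ≤ _ := by gcongr

lemma rotate_mem_altCycles [Fintype V] {G : SimpleGraph V} {k : ℕ} [NeZero k]
    {p : (Fin k → V) × (Fin k → V)} (h : p ∈ altCycles G k) (j : Fin k) :
    ((fun i => p.1 (i + j), fun i => p.2 (i + j)) : (Fin k → V) × (Fin k → V)) ∈
      altCycles G k := by
  obtain ⟨h1, h2, h3, h4, h5⟩ := mem_altCycles.1 h
  refine mem_altCycles.2 ⟨fun a b hab => add_right_cancel (h1 hab),
    fun a b hab => add_right_cancel (h2 hab), fun a b => h3 _ _, fun a => h4 _, fun a => ?_⟩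
  have := h5 (a + j)
  rwa [add_right_comm] at this

lemma rotate_injective {k : ℕ} [NeZero k] (j : Fin k) :
    Function.Injective fun p : (Fin k → V) × (Fin k → V) =>
      ((fun i => p.1 (i + j), fun i => p.2 (i + j)) : (Fin k → V) × (Fin k → V)) := by
  rintro ⟨a, b⟩ ⟨c, d⟩ h
  simp only [Prod.mk.injEq] at h
  refine Prod.ext (funext fun i => ?_) (funext fun i => ?_)
  · simpa using congrFun h.1 (i - j)
  · simpa using congrFun h.2 (i - j)

lemma shift_injective {k : ℕ} [NeZero k] :
    Function.Injective fun p : (Fin k → V) × (Fin k → V) =>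
      ((p.2, fun i => p.1 (i + 1)) : (Fin k → V) × (Fin k → V)) := by
  rintro ⟨a, b⟩ ⟨c, d⟩ h
  simp only [Prod.mk.injEq] at h
  refine Prod.ext (funext fun i => ?_) h.1
  simpa using congrFun h.2 (i - 1)

lemma card_altCycles_fst_eq_le [Fintype V] (G : SimpleGraph V) {k : ℕ} [NeZero k] (x : V)
    (j : Fin k) :
    #((altCycles G k).filter fun p => p.1 j = x) ≤
      #((altCycles G k).filter fun p => p.1 0 = x) := by
  refine card_le_card_of_injOn _ (fun p hp => ?_) (rotate_injective j).injOn
  simp only [coe_filter, Set.mem_ofPred_eq] at hp ⊢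
  exact ⟨rotate_mem_altCycles hp.1 j, by simpa using hp.2⟩

lemma card_altCycles_snd_eq_le [Fintype V] (G : SimpleGraph V) {k : ℕ} [NeZero k] (x : V)
    (j : Fin k) :
    #((altCycles G k).filter fun p => p.2 j = x) ≤
      #((altCycles G k).filter fun p => p.1 j = x) := by
  refine card_le_card_of_injOn _ (fun p hp => ?_) shift_injective.injOn
  simp only [coe_filter, Set.mem_ofPred_eq] at hp ⊢
  exact ⟨shift_mem_altCycles hp.1, hp.2⟩

lemma card_altCycles_through_le [Fintype V] (G : SimpleGraph V) {k : ℕ} [NeZero k] (x : V) :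
    #((altCycles G k).filter fun p => ∃ i, p.1 i = x ∨ p.2 i = x) ≤
      2 * k * #((altCycles G k).filter fun p => p.1 0 = x) := by
  have hsub : (altCycles G k).filter (fun p => ∃ i, p.1 i = x ∨ p.2 i = x) ⊆
      (univ : Finset (Fin k)).biUnion fun i => (altCycles G k).filter (fun p => p.1 i = x) ∪
        (altCycles G k).filter (fun p => p.2 i = x) := by
    intro p hp
    obtain ⟨hp, i, hi⟩ := mem_filter.1 hp
    simp only [mem_biUnion, mem_union, mem_filter, mem_univ, true_and]
    exact ⟨i, hi.imp (fun h => ⟨hp, h⟩) fun h => ⟨hp, h⟩⟩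
  refine (card_le_card hsub).trans ((card_biUnion_le_card_mul _ _
    (2 * #((altCycles G k).filter fun p => p.1 0 = x)) fun i _ => ?_).trans ?_)
  · refine (card_union_le _ _).trans ?_
    have h1 := card_altCycles_fst_eq_le G x i
    have h2 := card_altCycles_snd_eq_le G x i
    omega
  · rw [card_univ, Fintype.card_fin]
    exact le_of_eq (by ring)

/-- The join of the complete graph on `S` and the edgeless graph on the complement of `S`. -/
def joinOn (S : Finset V) : SimpleGraph V where
  Adj u v := u ≠ v ∧ (u ∈ S ∨ v ∈ S)
  symm := ⟨fun _ _ h => ⟨h.1.symm, h.2.symm⟩⟩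
  loopless := ⟨fun _ h => h.1 rfl⟩

lemma joinOn_adj {S : Finset V} {u v : V} : (joinOn S).Adj u v ↔ u ≠ v ∧ (u ∈ S ∨ v ∈ S) :=
  Iff.rfl

lemma card_le_of_mem_altCycles_joinOn [Fintype V] {S : Finset V} {k : ℕ} [NeZero k]
    {p : (Fin k → V) × (Fin k → V)} (hp : p ∈ altCycles (joinOn S) k) : k ≤ #S := by
  obtain ⟨h1, h2, h3, h4, -⟩ := mem_altCycles.1 hp
  let f : Fin k → V := fun i => if p.1 i ∈ S then p.1 i else p.2 i
  have hf : ∀ i, f i ∈ S := fun i => by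
    simp only [f]
    split_ifs with h
    · exact h
    · exact (h4 i).2.resolve_left h
  have hinj : Function.Injective f := fun i j hij => by
    simp only [f] at hij
    split_ifs at hij
    · exact h1 hij
    · exact absurd hij (h3 _ _)
    · exact absurd hij.symm (h3 _ _)
    · exact h2 hij
  simpa using card_le_card_of_injOn (s := univ) f (fun i _ => hf i) hinj.injOn

lemma fst_notMem_of_altCycles_joinOn [Fintype V] {S : Finset V} {t : ℕ}
    {p : (Fin (t + 1) → V) × (Fin (t + 1) → V)} (hp : p ∈ altCycles (joinOn S) (t + 1))
    (h0 : p.1 0 ∉ S) (hS : ∀ i, ¬ (p.1 i ∈ S ∧ p.2 i ∈ S)) (i : Fin (t + 1)) : p.1 i ∉ S := by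
  obtain ⟨-, -, -, h4, h5⟩ := mem_altCycles.1 hp
  have hstep : ∀ i, p.1 (i + 1) ∉ S → p.1 i ∉ S := fun i hi h =>
    hS i ⟨h, (h5 i).2.resolve_right hi⟩
  induction i using Fin.reverseInduction with
  | last => exact hstep _ (by simpa using h0)
  | cast i ih => exact hstep _ (by simpa using ih)

lemma prod_ite_zero_ite {k a b c : ℕ} {i : Fin (k + 2)} (hi : i ≠ 0) :
    ∏ j : Fin (k + 2), (if j = 0 then a else if j = i then b else c) = a * b * c ^ k := by
  obtain ⟨i, rfl⟩ := Fin.exists_succ_eq.2 hi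
  rw [Fin.prod_univ_succ, Fin.prod_univ_succAbove _ i]
  simp [Fin.succ_ne_zero, mul_assoc]

/-- Ordered pairs with at least one entry in `S`. -/
noncomputable def touchingPairs [Fintype V] (S : Finset V) : Finset (V × V) :=
  S ×ˢ univ ∪ univ ×ˢ S

lemma card_touchingPairs_le [Fintype V] (S : Finset V) :
    #(touchingPairs S) ≤ 2 * #S * Fintype.card V := by
  refine (card_union_le _ _).trans ?_
  rw [card_product, card_product, card_univ]
  exact le_of_eq (by ring)

lemma card_altCycles_joinOn_fst_eq_le [Fintype V] {S : Finset V} {t : ℕ} {x : V} (hx : x ∉ S) :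
    #((altCycles (joinOn S) (t + 3)).filter fun p => p.1 0 = x) ≤
      (#S).descFactorial (t + 3) * Fintype.card V ^ (t + 2) +
        (t + 3) * (#S ^ 3 * (2 * #S * Fintype.card V) ^ (t + 1)) := by
  let A : Finset ((Fin (t + 3) → V) × (Fin (t + 3) → V)) :=
    (Fintype.piFinset fun i : Fin (t + 3) => if i = 0 then {x} else univ) ×ˢ
      injChoices fun _ => S
  let F : Fin (t + 3) → Fin (t + 3) → Finset (V × V) := fun i j =>
    if j = 0 then {x} ×ˢ S else if j = i then S ×ˢ S else touchingPairs S
  let g : (Fin (t + 3) → V × V) → (Fin (t + 3) → V) × (Fin (t + 3) → V) :=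
    fun q => (fun i => (q i).1, fun i => (q i).2)
  have hsub : (altCycles (joinOn S) (t + 3)).filter (fun p => p.1 0 = x) ⊆
      A ∪ ((univ : Finset (Fin (t + 3))).filter fun i => i ≠ 0).biUnion
        fun i => (Fintype.piFinset (F i)).image g := by
    intro p hp
    obtain ⟨hp, h0⟩ := mem_filter.1 hp
    obtain ⟨-, h2, -, h4, -⟩ := mem_altCycles.1 hp
    by_cases hS : ∀ i, ¬ (p.1 i ∈ S ∧ p.2 i ∈ S)
    · refine mem_union_left _ (mem_product.2 ⟨Fintype.mem_piFinset.2 fun i => ?_,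
        mem_injChoices.2 ⟨fun i => ?_, h2⟩⟩)
      · split_ifs with hi
        · simp [hi, h0]
        · exact mem_univ _
      · exact (h4 i).2.resolve_left
          (fst_notMem_of_altCycles_joinOn hp (by rwa [h0]) hS i)
    · push Not at hS
      obtain ⟨i, hi1, hi2⟩ := hS
      refine mem_union_right _ (mem_biUnion.2 ⟨i, ?_, mem_image.2
        ⟨fun j => (p.1 j, p.2 j), Fintype.mem_piFinset.2 fun j => ?_, rfl⟩⟩)
      · refine mem_filter.2 ⟨mem_univ _, fun h => hx ?_⟩
        rwa [← h0, ← h]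
      · simp only [F]
        split_ifs with hj hj'
        · subst hj
          exact mem_product.2 ⟨by simpa using h0, (h4 0).2.resolve_left (by rwa [h0])⟩
        · subst hj'
          exact mem_product.2 ⟨hi1, hi2⟩
        · rcases (h4 j).2 with h | h
          · exact mem_union_left _ (mem_product.2 ⟨h, mem_univ _⟩)
          · exact mem_union_right _ (mem_product.2 ⟨mem_univ _, h⟩)
  refine (card_le_card hsub).trans ((card_union_le _ _).trans (Nat.add_le_add ?_ ?_))
  · rw [card_product, card_injChoices_const, Fintype.card_piFinset, mul_comm]
    refine le_of_eq ?_
    congr 1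
    rw [Fin.prod_univ_succ]
    simp [Fin.succ_ne_zero]
  · refine (card_biUnion_le_card_mul _ _ (#S ^ 3 * (2 * #S * Fintype.card V) ^ (t + 1))
      fun i hi => ?_).trans (Nat.mul_le_mul_right _ ((card_filter_le _ _).trans (by simp)))
    refine card_image_le.trans ?_
    rw [Fintype.card_piFinset]
    calc ∏ j, #(F i j)
        ≤ ∏ j, (if j = 0 then #S else if j = i then #S ^ 2 else 2 * #S * Fintype.card V) := by
          refine prod_le_prod' fun j _ => ?_
          simp only [F]
          split_ifs
          · simp
          · rw [card_product, sq]
          · exact card_touchingPairs_le S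
      _ = #S * #S ^ 2 * (2 * #S * Fintype.card V) ^ (t + 1) :=
          prod_ite_zero_ite (mem_filter.1 hi).2
      _ = #S ^ 3 * (2 * #S * Fintype.card V) ^ (t + 1) := by ring

lemma card_altCycles_joinOn_le [Fintype V] (S : Finset V) (t : ℕ) :
    #(altCycles (joinOn S) (t + 3)) ≤
      2 * (Fintype.card V * ((#S).descFactorial (t + 3) * Fintype.card V ^ (t + 2) +
        (t + 3) * (#S ^ 3 * (2 * #S * Fintype.card V) ^ (t + 1)))) +
      #S ^ 2 * (2 * #S * Fintype.card V) ^ (t + 2) := by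
  let B : Fin (t + 3) → Finset (V × V) := fun j => if j = 0 then S ×ˢ S else touchingPairs S
  let g : (Fin (t + 3) → V × V) → (Fin (t + 3) → V) × (Fin (t + 3) → V) :=
    fun q => (fun i => (q i).1, fun i => (q i).2)
  have hsub : altCycles (joinOn S) (t + 3) ⊆
      (Sᶜ.biUnion fun x => (altCycles (joinOn S) (t + 3)).filter (fun p => p.1 0 = x) ∪
        (altCycles (joinOn S) (t + 3)).filter (fun p => p.2 0 = x)) ∪
      (Fintype.piFinset B).image g := by
    intro p hp
    obtain ⟨-, -, -, h4, -⟩ := mem_altCycles.1 hp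
    by_cases h1 : p.1 0 ∈ S
    · by_cases h2 : p.2 0 ∈ S
      · refine mem_union_right _ (mem_image.2
          ⟨fun j => (p.1 j, p.2 j), Fintype.mem_piFinset.2 fun j => ?_, rfl⟩)
        simp only [B]
        split_ifs with hj
        · subst hj
          exact mem_product.2 ⟨h1, h2⟩
        · rcases (h4 j).2 with h | h
          · exact mem_union_left _ (mem_product.2 ⟨h, mem_univ _⟩)
          · exact mem_union_right _ (mem_product.2 ⟨mem_univ _, h⟩)
      · refine mem_union_left _ (mem_biUnion.2 ⟨p.2 0, mem_compl.2 h2, ?_⟩)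
        exact mem_union_right _ (mem_filter.2 ⟨hp, rfl⟩)
    · refine mem_union_left _ (mem_biUnion.2 ⟨p.1 0, mem_compl.2 h1, ?_⟩)
      exact mem_union_left _ (mem_filter.2 ⟨hp, rfl⟩)
  refine (card_le_card hsub).trans ((card_union_le _ _).trans (Nat.add_le_add ?_ ?_))
  · refine (card_biUnion_le_card_mul _ _ (2 * ((#S).descFactorial (t + 3) *
      Fintype.card V ^ (t + 2) + (t + 3) * (#S ^ 3 * (2 * #S * Fintype.card V) ^ (t + 1))))
      fun x hx => ?_).trans ?_
    · have h1 := card_altCycles_joinOn_fst_eq_le (t := t) (mem_compl.1 hx)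
      have h2 := card_altCycles_snd_eq_le (joinOn S) x (0 : Fin (t + 3))
      refine (card_union_le _ _).trans ?_
      omega
    · rw [mul_left_comm]
      exact Nat.mul_le_mul_left _ (Nat.mul_le_mul_right _ (card_le_univ _))
  · refine card_image_le.trans ?_
    rw [Fintype.card_piFinset, Fin.prod_univ_succ]
    refine Nat.mul_le_mul ?_ ?_
    · simp [B, sq]
    · calc ∏ i : Fin (t + 2), #(B i.succ) ≤ ∏ _i : Fin (t + 2), 2 * #S * Fintype.card V := by
            refine prod_le_prod' fun j _ => ?_
            simpa [B, Fin.succ_ne_zero] using card_touchingPairs_le S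
        _ = _ := by simp

/-- The vertices adjacent to all of `S`. -/
noncomputable def commonNbrs [Fintype V] (G : SimpleGraph V) (S : Finset V) : Finset V :=
  univ.filter fun x => ∀ y ∈ S, G.Adj x y

lemma mem_commonNbrs [Fintype V] {G : SimpleGraph V} {S : Finset V} {x : V} :
    x ∈ commonNbrs G S ↔ ∀ y ∈ S, G.Adj x y := by
  simp [commonNbrs]

/-- The vertices neither in `S` nor adjacent to all of `S`. -/
noncomputable def remainder [Fintype V] (G : SimpleGraph V) (S : Finset V) : Finset V :=
  (S ∪ commonNbrs G S)ᶜ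

lemma mem_remainder [Fintype V] {G : SimpleGraph V} {S : Finset V} {x : V} :
    x ∈ remainder G S ↔ x ∉ S ∧ x ∉ commonNbrs G S := by
  simp [remainder]

lemma not_adj_of_mem_commonNbrs [Fintype V] {G : SimpleGraph V} {S : Finset V}
    (hG : G.CliqueFree (#S + 2)) (hS : G.IsClique S) {x y : V} (hx : x ∈ commonNbrs G S)
    (hy : y ∈ commonNbrs G S) : ¬ G.Adj x y := by
  intro hxy
  have h1 : G.IsNClique (#S + 1) (insert y S) :=
    IsNClique.insert ⟨hS, rfl⟩ (mem_commonNbrs.1 hy)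
  refine hG _ (h1.insert (a := x) fun z hz => ?_)
  rcases mem_insert.1 hz with rfl | hz
  · exact hxy
  · exact mem_commonNbrs.1 hx z hz

lemma card_joinOn_avoiding_le [Fintype V] {G : SimpleGraph V} {S : Finset V}
    (hS : G.IsClique S) (k : ℕ) [NeZero k] :
    #((altCycles (joinOn S) k).filter fun p =>
        ¬ ∃ i, p.1 i ∈ remainder G S ∨ p.2 i ∈ remainder G S) ≤
      #((altCycles G k).filter fun p =>
        ¬ ∃ i, p.1 i ∈ remainder G S ∨ p.2 i ∈ remainder G S) := by
  have hmem : ∀ v, v ∉ remainder G S → v ∈ S ∨ v ∈ commonNbrs G S := fun v hv => by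
    rw [mem_remainder] at hv
    tauto
  have hadj : ∀ u v, u ∉ remainder G S → v ∉ remainder G S → (joinOn S).Adj u v → G.Adj u v := by
    rintro u v hu hv ⟨hne, h | h⟩
    · rcases hmem v hv with h' | h'
      · exact hS h h' hne
      · exact (mem_commonNbrs.1 h' u h).symm
    · rcases hmem u hu with h' | h'
      · exact hS h' h hne
      · exact mem_commonNbrs.1 h' v h
  refine card_le_card fun p hp => ?_
  obtain ⟨hp, hR⟩ := mem_filter.1 hp
  refine mem_filter.2 ⟨?_, hR⟩
  push Not at hR
  obtain ⟨h1, h2, h3, h4, h5⟩ := mem_altCycles.1 hp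
  exact mem_altCycles.2 ⟨h1, h2, h3, fun i => hadj _ _ (hR i).1 (hR i).2 (h4 i),
    fun i => hadj _ _ (hR i).2 (hR _).1 (h5 i)⟩

lemma card_joinOn_meeting_le [Fintype V] {G : SimpleGraph V} {S : Finset V} (t : ℕ) :
    #((altCycles (joinOn S) (t + 3)).filter fun p =>
        ∃ i, p.1 i ∈ remainder G S ∨ p.2 i ∈ remainder G S) ≤
      #(remainder G S) * (2 * (t + 3) *
        ((#S).descFactorial (t + 3) * Fintype.card V ^ (t + 2) +
        (t + 3) * (#S ^ 3 * (2 * #S * Fintype.card V) ^ (t + 1)))) := by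
  have hsub : ((altCycles (joinOn S) (t + 3)).filter fun p =>
        ∃ i, p.1 i ∈ remainder G S ∨ p.2 i ∈ remainder G S) ⊆
      (remainder G S).biUnion fun x => (altCycles (joinOn S) (t + 3)).filter fun p =>
        ∃ i, p.1 i = x ∨ p.2 i = x := by
    intro p hp
    obtain ⟨hp, i, hi | hi⟩ := mem_filter.1 hp
    · exact mem_biUnion.2 ⟨_, hi, mem_filter.2 ⟨hp, i, Or.inl rfl⟩⟩
    · exact mem_biUnion.2 ⟨_, hi, mem_filter.2 ⟨hp, i, Or.inr rfl⟩⟩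
  refine (card_le_card hsub).trans (card_biUnion_le_card_mul _ _ _ fun x hx => ?_)
  exact (card_altCycles_through_le _ x).trans (Nat.mul_le_mul_left _
    (card_altCycles_joinOn_fst_eq_le (mem_remainder.1 hx).1))

/-- If every remaining vertex yields more cycles in `G` than in the join, then `G` has more cycles
than the join. -/
lemma card_altCycles_joinOn_lt [Fintype V] {G : SimpleGraph V} {S : Finset V}
    (hS : G.IsClique S) (t : ℕ)
    (h : #(remainder G S) * (2 * (t + 3) *
        ((#S).descFactorial (t + 3) * Fintype.card V ^ (t + 2) +
        (t + 3) * (#S ^ 3 * (2 * #S * Fintype.card V) ^ (t + 1)))) <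
      #((altCycles G (t + 3)).filter fun p =>
        ∃ i, p.1 i ∈ remainder G S ∨ p.2 i ∈ remainder G S)) :
    #(altCycles (joinOn S) (t + 3)) < #(altCycles G (t + 3)) := by
  have h1 := card_joinOn_avoiding_le hS (t + 3)
  have h2 := card_joinOn_meeting_le (G := G) (S := S) t
  rw [← card_filter_add_card_filter_not (s := altCycles (joinOn S) (t + 3)) fun p =>
        ∃ i, p.1 i ∈ remainder G S ∨ p.2 i ∈ remainder G S,
    ← card_filter_add_card_filter_not (s := altCycles G (t + 3)) fun p =>
        ∃ i, p.1 i ∈ remainder G S ∨ p.2 i ∈ remainder G S]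
  omega

/-- The number of neighbours of `x` that are adjacent to all of `S`. -/
noncomputable def commonDegree [Fintype V] (G : SimpleGraph V) (S : Finset V) (x : V) : ℕ :=
  #((commonNbrs G S).filter fun u => G.Adj x u)

lemma pow_le_card_meeting [Fintype V] {G : SimpleGraph V} {S : Finset V} {t : ℕ}
    (hk : t + 3 ≤ #S) {x : V} (hx : x ∈ remainder G S) :
    (commonDegree G S x - (t + 3)) ^ (t + 3) ≤
      #((altCycles G (t + 3)).filter fun p =>
        ∃ i, p.1 i ∈ remainder G S ∨ p.2 i ∈ remainder G S) := by
  obtain ⟨g⟩ : Nonempty (Fin (t + 3) ↪ S) :=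
    Function.Embedding.nonempty_of_card_le (by simpa using hk)
  obtain ⟨hxS, hxU⟩ := mem_remainder.1 hx
  let w : Fin (t + 3) → V := fun i => if i = 0 then x else g i
  have hw : ∀ i, w i = x ∨ w i ∈ S := fun i => by
    simp only [w]
    split_ifs
    · exact Or.inl rfl
    · exact Or.inr (g i).2
  have hwinj : Function.Injective w := fun i j hij => by
    simp only [w] at hij
    split_ifs at hij with h1 h2 h2
    · rw [h1, h2]
    · exact absurd (hij ▸ (g j).2) hxS
    · exact absurd (hij ▸ (g i).2) hxS
    · exact g.injective (Subtype.ext hij)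
  have hcard : (commonDegree G S x - (t + 3)) ^ (t + 3) ≤
      #(injChoices fun _ : Fin (t + 3) => (commonNbrs G S).filter fun u => G.Adj x u) := by
    refine le_trans ?_ (prod_sub_le_card_injChoices _)
    calc (commonDegree G S x - (t + 3)) ^ (t + 3)
        = ∏ _i : Fin (t + 3), (commonDegree G S x - (t + 3)) := by simp
      _ ≤ _ := prod_le_prod' fun i _ => Nat.sub_le_sub_left i.2.le _
  refine hcard.trans (card_le_card_of_injOn (fun v => (v, w)) (fun v hv => ?_) ?_)
  · have hv := mem_injChoices.1 (mem_coe.1 hv)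
    have hvU : ∀ i, v i ∈ commonNbrs G S := fun i => (mem_filter.1 (hv.1 i)).1
    have hadj : ∀ i j, G.Adj (v i) (w j) := fun i j => by
      rcases hw j with h | h
      · rw [h]
        exact (mem_filter.1 (hv.1 i)).2.symm
      · exact mem_commonNbrs.1 (hvU i) _ h
    refine mem_coe.2 (mem_filter.2 ⟨mem_altCycles.2 ⟨hv.2, hwinj, fun i j => (hadj i j).ne,
      fun i => hadj _ _, fun i => (hadj _ _).symm⟩, 0, Or.inr ?_⟩)
    simpa [w] using hx
  · intro a _ b _ h
    exact congrArg Prod.fst h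

lemma isSelection_ite [Fintype V] {G : SimpleGraph V} {S₀ : Finset V} (hS₀ : G.IsClique S₀)
    {S : V → V → Finset V} (hS : IsSelection G #S₀ S) :
    IsSelection G #S₀ fun u v =>
      if u ∈ commonNbrs G S₀ ∧ v ∈ commonNbrs G S₀ then S₀ else S u v := by
  intro u v huv hadj
  by_cases h : u ∈ commonNbrs G S₀ ∧ v ∈ commonNbrs G S₀
  · simp only [h, and_self, if_true]
    exact ⟨trivial, hS₀, fun y hy => ⟨mem_commonNbrs.1 h.1 y hy, (mem_commonNbrs.1 h.2 y hy).symm⟩⟩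
  · simp only [h, if_false]
    exact hS u v huv hadj

/-- Labelled cycles whose first vertex sequence lies in the common neighbourhood of `S` except for
the vertex `x` at position `i`, and whose second sequence avoids that common neighbourhood. -/
noncomputable def cyclesAt [Fintype V] (G : SimpleGraph V) (S : Finset V) {k : ℕ} [NeZero k]
    (x : V) (i : Fin k) : Finset ((Fin k → V) × (Fin k → V)) :=
  (altCycles G k).filter fun p => p.1 i = x ∧ (∀ j, j ≠ i → p.1 j ∈ commonNbrs G S) ∧
    ∀ j, p.2 j ∉ commonNbrs G S

lemma card_cyclesAt_zero_le [Fintype V] (G : SimpleGraph V) (S : Finset V) {k : ℕ} [NeZero k]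
    (x : V) (i : Fin k) : #(cyclesAt G S x (0 : Fin k)) ≤ #(cyclesAt G S x i) := by
  refine card_le_card_of_injOn _ (fun p hp => ?_) (rotate_injective (-i)).injOn
  obtain ⟨hp, h0, h1, h2⟩ := mem_filter.1 (mem_coe.1 hp)
  refine mem_coe.2 (mem_filter.2 ⟨rotate_mem_altCycles hp (-i), by simpa using h0,
    fun j hj => h1 _ ?_, fun j => h2 _⟩)
  rwa [← sub_eq_add_neg, sub_ne_zero]

lemma le_card_cyclesAt_zero [Fintype V] {G : SimpleGraph V} {S₀ : Finset V} {t : ℕ}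
    (hk : t + 3 ≤ #S₀) (hG : G.CliqueFree (#S₀ + 2)) (hS₀ : G.IsClique S₀)
    {S : V → V → Finset V} (hS : IsSelection G #S₀ S) {x : V} (hx : x ∈ remainder G S₀) :
    ((#S₀).descFactorial (t + 3) + 1) *
      (#(commonNbrs G S₀) - commonDegree G S₀ x - (t + 3)) ^ (t + 2) ≤
      #(cyclesAt G S₀ x (0 : Fin (t + 3))) := by
  obtain ⟨-, hxU⟩ := mem_remainder.1 hx
  set U := commonNbrs G S₀ with hU
  set S' : V → V → Finset V := fun u v => if u ∈ U ∧ v ∈ U then S₀ else S u v with hS'def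
  have hS' : IsSelection G #S₀ S' := isSelection_ite hS₀ hS
  set A : Fin (t + 3) → Finset V := fun i =>
    if i = 0 then {x} else U.filter fun u => ¬ G.Adj x u with hA
  have hAc : (#U - commonDegree G S₀ x - (t + 3)) ^ (t + 2) ≤ #(injChoices A) := by
    refine le_trans ?_ (prod_sub_le_card_injChoices _)
    have hd : #(U.filter fun u => ¬ G.Adj x u) = #U - commonDegree G S₀ x := by
      have := card_filter_add_card_filter_not (s := U) fun u => G.Adj x u
      rw [commonDegree, ← hU]
      omega
    rw [Fin.prod_univ_succ]
    simp only [hA, if_true, Fin.succ_ne_zero, if_false, card_singleton, Fin.val_zero, hd]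
    calc (#U - commonDegree G S₀ x - (t + 3)) ^ (t + 2)
        = ∏ _i : Fin (t + 2), (#U - commonDegree G S₀ x - (t + 3)) := by simp
      _ ≤ ∏ i : Fin (t + 2), (#U - commonDegree G S₀ x - i.succ) :=
          prod_le_prod' fun i _ => Nat.sub_le_sub_left i.succ.2.le _
      _ = _ := by simp
  have hfacts : ∀ v ∈ injChoices A, v 0 = x ∧ (∀ j, j ≠ 0 → v j ∈ U) ∧
      v ∈ indepTuples G (t + 3) := fun v hv => by
    obtain ⟨hvA, hvinj⟩ := mem_injChoices.1 hv
    have h0 : v 0 = x := by simpa [hA] using hvA 0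
    have hj : ∀ j, j ≠ 0 → v j ∈ U ∧ ¬ G.Adj x (v j) := fun j hj => by
      simpa [hA, hj] using hvA j
    refine ⟨h0, fun j h => (hj j h).1, mem_indepTuples.2 ⟨hvinj, fun i j hadj => ?_⟩⟩
    by_cases hi0 : i = 0
    · by_cases hj0 : j = 0
      · rw [hi0, hj0] at hadj
        exact G.irrefl hadj
      · rw [hi0, h0] at hadj
        exact (hj j hj0).2 hadj
    · by_cases hj0 : j = 0
      · rw [hj0, h0] at hadj
        exact (hj i hi0).2 hadj.symm
      · exact not_adj_of_mem_commonNbrs hG hS₀ (hj i hi0).1 (hj j hj0).1 hadj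
  have hstrict : ∀ v ∈ injChoices A,
      (#S₀).descFactorial (t + 3) + 1 ≤ #(injChoices (selAlong S' v)) := fun v hv => by
    obtain ⟨h0, hj, hind⟩ := hfacts v hv
    obtain ⟨hvinj, hvadj⟩ := mem_indepTuples.1 hind
    have hsel := fun i => hS' (v i) (v (i + 1)) (fun h => ne_add_one_fin i (hvinj h)) (hvadj _ _)
    refine descFactorial_lt_card_injChoices (t := t + 1) hk _ (fun i => (hsel i).1) fun h => hxU ?_
    have h12 : (1 : Fin (t + 3)) + 1 ≠ 0 := by
      intro h
      simp only [Fin.ext_iff, Fin.val_add, Fin.val_one, Fin.val_zero] at h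
      rw [Nat.mod_eq_of_lt (by omega)] at h
      omega
    have h1 : selAlong S' v 1 = S₀ := by
      simp [selAlong, hS'def, hj 1 (by simp), hj _ h12]
    rw [hU, mem_commonNbrs]
    intro y hy
    rw [← h1] at hy
    have := ((hsel 0).2.2 y (by rw [← h] at hy; exact hy)).1
    rwa [h0] at this
  calc ((#S₀).descFactorial (t + 3) + 1) * (#U - commonDegree G S₀ x - (t + 3)) ^ (t + 2)
      ≤ ((#S₀).descFactorial (t + 3) + 1) * #(injChoices A) := Nat.mul_le_mul_left _ hAc
    _ ≤ ∑ v ∈ injChoices A, #(injChoices (selAlong S' v)) := by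
        rw [mul_comm, ← smul_eq_mul]
        exact card_nsmul_le_sum _ _ _ hstrict
    _ = #((injChoices A).sigma fun v => injChoices (selAlong S' v)) := (card_sigma _ _).symm
    _ ≤ _ := by
        refine card_le_card_of_injOn (fun q => (q.1, q.2)) ?_ ?_
        · rintro ⟨v, w⟩ hq
          rw [mem_coe, mem_sigma] at hq
          obtain ⟨h0, hj, hind⟩ := hfacts v hq.1
          have halt := mem_altCycles_of_mem_injChoices hS' hind hq.2
          obtain ⟨-, -, -, h4, h5⟩ := mem_altCycles.1 halt
          refine mem_coe.2 (mem_filter.2 ⟨halt, h0, hj, fun j hjU => ?_⟩)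
          by_cases hj0 : j = 0
          · refine not_adj_of_mem_commonNbrs hG hS₀ hjU (hj (j + 1) ?_) (h5 j)
            rw [hj0]
            simp
          · exact not_adj_of_mem_commonNbrs hG hS₀ (hj j hj0) hjU (h4 j)
        · rintro ⟨a, b⟩ _ ⟨c, d⟩ _ h
          simp only [Prod.mk.injEq] at h
          rw [h.1, h.2]

lemma sum_card_cyclesAt_le [Fintype V] (G : SimpleGraph V) (S : Finset V) (t : ℕ) :
    2 * (t + 3) * ∑ x ∈ remainder G S, #(cyclesAt G S x (0 : Fin (t + 3))) ≤
      #((altCycles G (t + 3)).filter fun p =>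
        ∃ i, p.1 i ∈ remainder G S ∨ p.2 i ∈ remainder G S) := by
  set H := (remainder G S ×ˢ (univ : Finset (Fin (t + 3)))).biUnion
    fun q => cyclesAt G S q.1 q.2 with hH
  have hHcard : (t + 3) * ∑ x ∈ remainder G S, #(cyclesAt G S x (0 : Fin (t + 3))) ≤ #H := by
    rw [hH, card_biUnion]
    · rw [sum_product, mul_sum]
      refine sum_le_sum fun x _ => ?_
      calc (t + 3) * #(cyclesAt G S x (0 : Fin (t + 3)))
          = ∑ _i : Fin (t + 3), #(cyclesAt G S x (0 : Fin (t + 3))) := by simp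
        _ ≤ _ := sum_le_sum fun i _ => card_cyclesAt_zero_le G S x i
    · rintro ⟨x, i⟩ hx ⟨y, j⟩ hy hne
      have hx := (mem_remainder.1 (mem_product.1 hx).1).2
      refine disjoint_left.2 fun p hp hp' => ?_
      obtain ⟨-, h1, h2, -⟩ := mem_filter.1 hp
      obtain ⟨-, h1', h2', -⟩ := mem_filter.1 hp'
      by_cases hij : i = j
      · subst hij
        exact hne (Prod.ext (h1.symm.trans h1') rfl)
      · have h3 := h2' i hij
        rw [show p.1 i = x from h1] at h3
        exact hx h3
  have hHmem : ∀ p ∈ H, p ∈ altCycles G (t + 3) ∧ (∃ i, p.1 i ∈ remainder G S) ∧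
      (∃ i, p.1 i ∈ commonNbrs G S) ∧ ∀ i, p.2 i ∉ commonNbrs G S := fun p hp => by
    obtain ⟨⟨x, i⟩, hx, hp⟩ := mem_biUnion.1 hp
    obtain ⟨h0, h1, h2, h3⟩ := mem_filter.1 hp
    exact ⟨h0, ⟨i, h1 ▸ (mem_product.1 hx).1⟩, ⟨i + 1, h2 _ (ne_add_one_fin i).symm⟩, h3⟩
  let f : (Fin (t + 3) → V) × (Fin (t + 3) → V) → (Fin (t + 3) → V) × (Fin (t + 3) → V) :=
    fun p => (p.2, fun i => p.1 (i + 1))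
  have hdisj : Disjoint H (H.image f) := by
    refine disjoint_left.2 fun p hp hp' => ?_
    obtain ⟨q, hq, rfl⟩ := mem_image.1 hp'
    obtain ⟨-, -, ⟨i, hi⟩, -⟩ := hHmem q hq
    exact (hHmem _ hp).2.2.2 (i - 1) (by simpa [f] using hi)
  have hcard : #(H ∪ H.image f) = 2 * #H := by
    rw [card_union_of_disjoint hdisj, card_image_of_injective _ shift_injective]
    ring
  have hsub : H ∪ H.image f ⊆ (altCycles G (t + 3)).filter fun p =>
      ∃ i, p.1 i ∈ remainder G S ∨ p.2 i ∈ remainder G S := by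
    refine union_subset (fun p hp => ?_) (image_subset_iff.2 fun p hp => ?_)
    · obtain ⟨h0, ⟨i, hi⟩, -⟩ := hHmem p hp
      exact mem_filter.2 ⟨h0, i, Or.inl hi⟩
    · obtain ⟨h0, ⟨i, hi⟩, -⟩ := hHmem p hp
      exact mem_filter.2 ⟨shift_mem_altCycles h0, i - 1, Or.inr (by simpa [f] using hi)⟩
  have := card_le_card hsub
  rw [hcard] at this
  refine le_trans ?_ this
  rw [mul_assoc]
  exact Nat.mul_le_mul_left _ hHcard

lemma addEdge_adj {G : SimpleGraph V} {u v x y : V} :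
    (addEdge G u v).Adj x y ↔ G.Adj x y ∨ s(x, y) = s(u, v) ∧ x ≠ y := by
  simp [addEdge]

lemma KSat.exists_isSelection {m : ℕ} {G : SimpleGraph V} (h : KSat (m + 2) G) :
    ∃ S, IsSelection G m S := by
  have key : ∀ u v, ∃ T : Finset V, u ≠ v → ¬ G.Adj u v →
      #T = m ∧ G.IsClique T ∧ ∀ y ∈ T, G.Adj u y ∧ G.Adj y v := by
    intro u v
    by_cases huv : u = v
    · exact ⟨∅, fun h => absurd huv h⟩
    by_cases hadj : G.Adj u v
    · exact ⟨∅, fun _ h => absurd hadj h⟩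
    have h2 := h.2 u v huv hadj
    rw [CliqueFree] at h2
    push Not at h2
    obtain ⟨T, hT, hTc⟩ := h2
    have hG : ∀ x ∈ T, ∀ y ∈ T, x ≠ y → s(x, y) ≠ s(u, v) → G.Adj x y := fun x hx y hy hxy hne =>
      (addEdge_adj.1 (hT hx hy hxy)).resolve_right fun h => hne h.1
    have hu : u ∈ T := by
      by_contra hu
      refine h.1 T ⟨fun x hx y hy hxy => hG x hx y hy hxy fun he => hu ?_, hTc⟩
      rcases Sym2.eq_iff.1 he with ⟨rfl, -⟩ | ⟨-, rfl⟩
      exacts [hx, hy]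
    have hv : v ∈ T := by
      by_contra hv
      refine h.1 T ⟨fun x hx y hy hxy => hG x hx y hy hxy fun he => hv ?_, hTc⟩
      rcases Sym2.eq_iff.1 he with ⟨-, rfl⟩ | ⟨rfl, -⟩
      exacts [hy, hx]
    refine ⟨(T.erase u).erase v, fun _ _ => ⟨?_, fun x hx y hy hxy => ?_, fun y hy => ?_⟩⟩
    · rw [card_erase_of_mem (mem_erase.2 ⟨Ne.symm huv, hv⟩), card_erase_of_mem hu, hTc]
      rfl
    · simp only [coe_erase, Set.mem_sdiff, Set.mem_singleton_iff, mem_coe] at hx hy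
      refine hG x hx.1.1 y hy.1.1 hxy fun he => ?_
      rcases Sym2.eq_iff.1 he with ⟨h1, -⟩ | ⟨h1, -⟩
      exacts [hx.1.2 h1, hx.2 h1]
    · obtain ⟨hyv, hyu, hyT⟩ := by simpa only [mem_erase] using hy
      refine ⟨hG u hu y hyT (Ne.symm hyu) fun he => ?_, hG y hyT v hv hyv fun he => ?_⟩
      · rcases Sym2.eq_iff.1 he with ⟨-, h1⟩ | ⟨-, h1⟩
        exacts [hyv h1, hyu h1]
      · rcases Sym2.eq_iff.1 he with ⟨h1, -⟩ | ⟨h1, -⟩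
        exacts [hyu h1, hyv h1]
  choose S hS using key
  exact ⟨S, hS⟩

lemma eq_joinOn_of_remainder_eq_empty [Fintype V] {G : SimpleGraph V} {S : Finset V}
    (hG : G.CliqueFree (#S + 2)) (hS : G.IsClique S) (hR : remainder G S = ∅) :
    G = joinOn S := by
  have hmem : ∀ v, v ∉ S → v ∈ commonNbrs G S := fun v hv => by
    by_contra h
    exact notMem_empty v (hR ▸ mem_remainder.2 ⟨hv, h⟩)
  ext u v
  rw [joinOn_adj]
  refine ⟨fun h => ⟨h.ne, ?_⟩, ?_⟩
  · by_contra hn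
    push Not at hn
    exact not_adj_of_mem_commonNbrs hG hS (hmem u hn.1) (hmem v hn.2) h
  · rintro ⟨hne, h | h⟩
    · by_cases hv : v ∈ S
      · exact hS h hv hne
      · exact (mem_commonNbrs.1 (hmem v hv) u h).symm
    · by_cases hu : u ∈ S
      · exact hS hu h hne
      · exact mem_commonNbrs.1 (hmem u hu) v h

lemma nonempty_joinOn_iso [Fintype V] {S T : Finset V} (h : #S = #T) :
    Nonempty (joinOn S ≃g joinOn T) := by
  have e : {x // x ∈ S} ≃ {x // x ∈ T} := Fintype.equivOfCardEq (by simpa using h)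
  have he : ∀ x, e.extendSubtype x ∈ T ↔ x ∈ S := fun x =>
    ⟨fun hx => by_contra fun hn => e.extendSubtype_not_mem x hn hx, e.extendSubtype_mem x⟩
  exact ⟨⟨e.extendSubtype, by simp [joinOn_adj, he]⟩⟩

lemma joinGraph_eq_joinOn (n s : ℕ) :
    joinGraph n s = joinOn (univ.filter fun i : Fin n => (i : ℕ) < s - 2) := by
  ext u v
  simp [joinGraph, joinOn_adj, SimpleGraph.fromRel_adj]

lemma card_filter_val_lt {n m : ℕ} (h : m ≤ n) :
    #(univ.filter fun i : Fin n => (i : ℕ) < m) = m := by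
  rw [Fin.card_filter_val_lt]
  omega

lemma card_altCycles_le_of_iso {W : Type*} [Fintype V] [Fintype W] {G : SimpleGraph V}
    {H : SimpleGraph W} (e : G ≃g H) (k : ℕ) [NeZero k] : #(altCycles G k) ≤ #(altCycles H k) := by
  refine card_le_card_of_injOn (fun p => (e ∘ p.1, e ∘ p.2)) (fun p hp => ?_) ?_
  · obtain ⟨h1, h2, h3, h4, h5⟩ := mem_altCycles.1 (mem_coe.1 hp)
    exact mem_coe.2 (mem_altCycles.2 ⟨e.injective.comp h1, e.injective.comp h2,
      fun i j h => h3 i j (e.injective h), fun i => e.map_adj_iff.2 (h4 i),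
      fun i => e.map_adj_iff.2 (h5 i)⟩)
  · intro p _ q _ h
    simp only [Prod.mk.injEq] at h
    exact Prod.ext (e.injective.comp_left h.1) (e.injective.comp_left h.2)

lemma card_altCycles_eq_of_iso {W : Type*} [Fintype V] [Fintype W] {G : SimpleGraph V}
    {H : SimpleGraph W} (e : G ≃g H) (k : ℕ) [NeZero k] : #(altCycles G k) = #(altCycles H k) :=
  (card_altCycles_le_of_iso e k).antisymm (card_altCycles_le_of_iso e.symm k)

lemma cycleCount_mul_card_aut [Finite V] (G : SimpleGraph V) (r : ℕ) :
    cycleCount G r * Nat.card (cycleGraph r ≃g cycleGraph r) = Nat.card (Copy (cycleGraph r) G) := by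
  rw [cycleCount, ← Nat.card_coe_set_eq, ← Nat.card_prod]
  let f : {H : G.Subgraph | Nonempty (H.coe ≃g cycleGraph r)} ×
      (cycleGraph r ≃g cycleGraph r) → Copy (cycleGraph r) G :=
    fun q => q.1.1.coeCopy.comp (Iso.toCopy (RelIso.trans q.2 q.1.2.some.symm))
  have hf : ∀ q x, f q x = q.1.2.some.symm (q.2 x) := fun q x => rfl
  have hsub : ∀ q, (f q).toSubgraph = q.1.1 := by
    rintro ⟨⟨H, hH⟩, σ⟩
    set e : cycleGraph r ≃g H.coe := σ.trans hH.some.symm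
    ext x y
    · simp only [Copy.toSubgraph, Subgraph.map_verts, Subgraph.verts_top, Set.image_univ,
        Set.mem_range]
      refine ⟨?_, fun hx => ⟨e.symm ⟨x, hx⟩, ?_⟩⟩
      · rintro ⟨z, rfl⟩
        exact (e z).2
      · exact congrArg Subtype.val (e.apply_symm_apply ⟨x, hx⟩)
    · simp only [Copy.toSubgraph, Subgraph.map_adj, Relation.map_apply, Subgraph.top_adj]
      constructor
      · rintro ⟨a, b, hab, rfl, rfl⟩
        exact e.map_adj_iff.2 hab
      · intro hxy
        have hx := H.edge_vert hxy
        have hy := H.edge_vert hxy.symm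
        refine ⟨e.symm ⟨x, hx⟩, e.symm ⟨y, hy⟩, e.symm.map_adj_iff.2 hxy,
          congrArg Subtype.val (e.apply_symm_apply ⟨x, hx⟩),
          congrArg Subtype.val (e.apply_symm_apply ⟨y, hy⟩)⟩
  refine Nat.card_congr (Equiv.ofBijective f ⟨?_, fun g => ?_⟩)
  · rintro ⟨H, σ⟩ ⟨H', σ'⟩ h
    obtain rfl : H = H' := Subtype.ext ((hsub _).symm.trans ((congrArg _ h).trans (hsub _)))
    refine Prod.ext rfl (RelIso.ext fun x => ?_)
    have := DFunLike.congr_fun h x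
    rw [hf, hf] at this
    exact H.2.some.symm.injective (Subtype.ext this)
  · have hg : Nonempty (g.toSubgraph.coe ≃g cycleGraph r) := ⟨g.isoToSubgraph.symm⟩
    refine ⟨⟨⟨g.toSubgraph, hg⟩, RelIso.trans g.isoToSubgraph hg.some⟩, ?_⟩
    ext x
    rw [hf]
    simp
    rfl

lemma cycleGraph_adj_finProdFinEquiv {k : ℕ} [NeZero k] (i j : Fin k) (a b : Fin 2) :
    (cycleGraph (k * 2)).Adj (finProdFinEquiv (i, a)) (finProdFinEquiv (j, b)) ↔
      (a = 0 ∧ b = 1 ∧ (i = j ∨ i = j + 1)) ∨ (a = 1 ∧ b = 0 ∧ (j = i ∨ j = i + 1)) := by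
  have hsub : ∀ u v : Fin (k * 2), (u - v).val = 1 ↔
      u.val = v.val + 1 ∨ (u.val = 0 ∧ v.val + 1 = k * 2 ∧ 2 ≤ k * 2) := fun u v => by
    rcases le_or_gt v u with h | h
    · rw [Fin.sub_val_of_le h]
      have h' : v.val ≤ u.val := h
      omega
    · have h' : u.val < v.val := h
      rw [Fin.val_sub, Nat.mod_eq_of_lt (by omega)]
      omega
  have hadd : ∀ i j : Fin k, j = i + 1 ↔
      j.val = i.val + 1 ∨ (j.val = 0 ∧ i.val + 1 = k) := fun i j => by
    rw [Fin.ext_iff, Fin.val_add, Fin.val_one', Nat.add_mod_mod]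
    rcases (Nat.succ_le_of_lt i.2).lt_or_eq with h | h
    · rw [Nat.mod_eq_of_lt h]
      omega
    · rw [show i.val + 1 = k from h, Nat.mod_self]
      omega
  rw [cycleGraph_adj', hsub, hsub, hadd, hadd]
  simp only [finProdFinEquiv_apply_val, Fin.ext_iff, Fin.val_zero, Fin.val_one]
  omega

lemma card_altCycles_eq [Fintype V] (G : SimpleGraph V) (k : ℕ) [NeZero k] :
    #(altCycles G k) = Nat.card (Copy (cycleGraph (k * 2)) G) := by
  rw [← Fintype.card_coe, ← Nat.card_eq_fintype_card]
  have hadj : ∀ i : Fin k, (cycleGraph (k * 2)).Adj (finProdFinEquiv (i, 0))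
      (finProdFinEquiv (i, 1)) := fun i => by simp [cycleGraph_adj_finProdFinEquiv]
  have hadj' : ∀ i : Fin k, (cycleGraph (k * 2)).Adj (finProdFinEquiv (i, 1))
      (finProdFinEquiv (i + 1, 0)) := fun i => by simp [cycleGraph_adj_finProdFinEquiv]
  have hne : ∀ (f : Copy (cycleGraph (k * 2)) G) (i j : Fin k) (a b : Fin 2),
      f (finProdFinEquiv (i, a)) = f (finProdFinEquiv (j, b)) → i = j ∧ a = b :=
    fun f i j a b h => Prod.mk.inj (finProdFinEquiv.injective (f.injective h))
  refine (Nat.card_congr (Equiv.ofBijective (fun f : Copy (cycleGraph (k * 2)) G =>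
    (⟨(fun i => f (finProdFinEquiv (i, 0)), fun i => f (finProdFinEquiv (i, 1))),
      mem_altCycles.2 ⟨fun i j h => (hne f _ _ _ _ h).1, fun i j h => (hne f _ _ _ _ h).1,
        fun i j h => absurd (hne f _ _ _ _ h).2 (by simp), fun i => f.toHom.map_adj (hadj i),
        fun i => f.toHom.map_adj (hadj' i)⟩⟩ : altCycles G k)) ⟨fun f g h => ?_, ?_⟩)).symm
  · obtain ⟨h0, h1⟩ := Prod.mk.inj (Subtype.mk.inj h)
    ext x
    obtain ⟨⟨i, a⟩, rfl⟩ := finProdFinEquiv.surjective x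
    fin_cases a
    exacts [congrFun h0 i, congrFun h1 i]
  · rintro ⟨p, hp⟩
    obtain ⟨h1, h2, h3, h4, h5⟩ := mem_altCycles.1 hp
    let g : Fin (k * 2) → V := fun x =>
      if (finProdFinEquiv.symm x).2 = 0 then p.1 (finProdFinEquiv.symm x).1
      else p.2 (finProdFinEquiv.symm x).1
    have hg : ∀ i a, g (finProdFinEquiv (i, a)) = if a = 0 then p.1 i else p.2 i := fun i a => by
      simp only [g, Equiv.symm_apply_apply]
    refine ⟨⟨⟨g, fun {x y} hxy => ?_⟩, fun x y hxy => ?_⟩, ?_⟩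
    · obtain ⟨⟨i, a⟩, rfl⟩ := finProdFinEquiv.surjective x
      obtain ⟨⟨j, b⟩, rfl⟩ := finProdFinEquiv.surjective y
      rw [cycleGraph_adj_finProdFinEquiv] at hxy
      rw [hg, hg]
      rcases hxy with ⟨rfl, rfl, rfl | rfl⟩ | ⟨rfl, rfl, rfl | rfl⟩
      exacts [h4 _, (h5 _).symm, (h4 _).symm, h5 _]
    · obtain ⟨⟨i, a⟩, rfl⟩ := finProdFinEquiv.surjective x
      obtain ⟨⟨j, b⟩, rfl⟩ := finProdFinEquiv.surjective y
      change g _ = g _ at hxy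
      rw [hg, hg] at hxy
      congr 1
      split_ifs at hxy with ha hb hb
      · rw [h1 hxy, ha, hb]
      · exact absurd hxy (h3 _ _)
      · exact absurd hxy.symm (h3 _ _)
      · rw [h2 hxy]
        congr 1
        omega
    · refine Subtype.ext (Prod.ext (funext fun i => ?_) (funext fun i => ?_))
      · exact hg i 0
      · exact hg i 1

lemma exists_cycleCount_mul_eq (k : ℕ) [NeZero k] :
    ∃ c, 0 < c ∧ ∀ {n : ℕ} (G : SimpleGraph (Fin n)), cycleCount G (k * 2) * c = #(altCycles G k) := by
  refine ⟨Nat.card (cycleGraph (k * 2) ≃g cycleGraph (k * 2)), ?_, fun G => ?_⟩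
  · have : Finite (cycleGraph (k * 2) ≃g cycleGraph (k * 2)) := DFunLike.finite _
    exact Nat.card_pos
  · rw [cycleCount_mul_card_aut, card_altCycles_eq]

/-- If most independent tuples have coinciding selected cliques at two consecutive places, then
some `m`-clique has a large common neighbourhood. -/
lemma IsSelection.exists_clique [Fintype V] {G : SimpleGraph V} {m t : ℕ}
    {S : V → V → Finset V} (hS : IsSelection G m S)
    (hpos : 0 < #((indepTuples G (t + 3)).filter fun v => S (v 0) (v 1) = S (v 1) (v 2))) :
    ∃ S₀ : Finset V, #S₀ = m ∧ G.IsClique S₀ ∧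
      #((indepTuples G (t + 3)).filter fun v => S (v 0) (v 1) = S (v 1) (v 2)) ≤
        Fintype.card V ^ (t + 2) * #(commonNbrs G S₀) := by
  set D := (indepTuples G (t + 3)).filter fun v => S (v 0) (v 1) = S (v 1) (v 2) with hD
  let π : (Fin (t + 3) → V) → Fin (t + 2) → V := fun v i => v ((2 : Fin (t + 3)).succAbove i)
  have h0 : ∀ v w, π v = π w → ∀ j, j ≠ 2 → v j = w j := fun v w h j hj => by
    obtain ⟨i, rfl⟩ := Fin.exists_succAbove_eq hj
    exact congrFun h i
  have hval : 2 % (t + 3) = 2 := Nat.mod_eq_of_lt (by omega)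
  have h02 : (0 : Fin (t + 3)) ≠ 2 := fun h => by simpa [hval] using congrArg Fin.val h
  have h12 : (1 : Fin (t + 3)) ≠ 2 := fun h => by simpa [hval] using congrArg Fin.val h
  have h01 : (0 : Fin (t + 3)) ≠ 1 := by simp
  obtain ⟨u, hu, hmax⟩ := exists_max_image (D.image π) (fun u => #(D.filter fun v => π v = u))
    ((card_pos.1 hpos).image π)
  obtain ⟨v, hv, rfl⟩ := mem_image.1 hu
  have hsel : ∀ w ∈ D, (∀ i j, i ≠ j → w i ≠ w j) ∧ (∀ i j, ¬ G.Adj (w i) (w j)) ∧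
      S (w 0) (w 1) = S (w 1) (w 2) := fun w hw => by
    obtain ⟨hw, he⟩ := mem_filter.1 hw
    exact ⟨fun i j hij => (mem_indepTuples.1 hw).1.ne hij, (mem_indepTuples.1 hw).2, he⟩
  obtain ⟨hv1, hv2, -⟩ := hsel v hv
  obtain ⟨hc, hcl, -⟩ := hS (v 0) (v 1) (hv1 _ _ h01) (hv2 _ _)
  refine ⟨S (v 0) (v 1), hc, hcl, ?_⟩
  have hfib : #(D.filter fun w => π w = π v) ≤ #(commonNbrs G (S (v 0) (v 1))) := by
    refine card_le_card_of_injOn (fun w => w 2) (fun w hw => ?_) fun w hw w' hw' h => ?_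
    · obtain ⟨hwD, hw⟩ := mem_filter.1 (mem_coe.1 hw)
      obtain ⟨hw1, hw2, he⟩ := hsel w hwD
      refine mem_coe.2 (mem_commonNbrs.2 fun y hy => ?_)
      rw [← h0 w v hw 0 h02, ← h0 w v hw 1 h12, he] at hy
      exact ((hS (w 1) (w 2) (hw1 _ _ h12) (hw2 _ _)).2.2 y hy).2.symm
    · have h' := h0 w w' ((mem_filter.1 (mem_coe.1 hw)).2.trans (mem_filter.1 (mem_coe.1 hw')).2.symm)
      funext j
      by_cases hj : j = 2
      · rw [hj]
        exact h
      · exact h' j hj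
  calc #D ≤ #(commonNbrs G (S (v 0) (v 1))) * #(D.image π) :=
        card_le_mul_card_image D _ fun u hu => (hmax u hu).trans hfib
    _ ≤ _ := by
        rw [mul_comm]
        refine Nat.mul_le_mul_right _ ((card_le_univ _).trans_eq ?_)
        simp

/-- The coefficient of the lower order term in the bound for the number of labelled cycles in a
join. -/
def joinConst (m t : ℕ) : ℕ :=
  2 * (t + 3) * m ^ 3 * (2 * m) ^ (t + 1) + m ^ 2 * (2 * m) ^ (t + 2)

lemma card_altCycles_joinOn_le_add [Fintype V] (S : Finset V) (t : ℕ) :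
    #(altCycles (joinOn S) (t + 3)) ≤ 2 * (#S).descFactorial (t + 3) * Fintype.card V ^ (t + 3) +
      joinConst #S t * Fintype.card V ^ (t + 2) := by
  refine (card_altCycles_joinOn_le S t).trans_eq ?_
  rw [joinConst]
  ring

lemma card_altCycles_joinOn_lt_of_dense [Fintype V] (G : SimpleGraph V) (S : Finset V) (t : ℕ)
    {c : ℝ} (hc : 0 ≤ c) (h : c * (Fintype.card V : ℝ) ^ 2 ≤ adjPairs G)
    (h1 : 2 * ((t : ℝ) + 3) ^ 2 + 1 ≤ c ^ ((t + 3) * (t + 3)) * Fintype.card V)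
    (h2 : 2 * (#S).descFactorial (t + 3) + joinConst #S t < Fintype.card V) :
    #(altCycles (joinOn S) (t + 3)) < #(altCycles G (t + 3)) := by
  have hpos : 0 < Fintype.card V := (Nat.zero_le _).trans_lt h2
  have hd := le_card_altCycles_of_dense G (t + 1) hc hpos h
  have hJ := card_altCycles_joinOn_le_add S t
  generalize 2 * (#S).descFactorial (t + 3) = a at *
  generalize joinConst #S t = b at *
  generalize Fintype.card V = n at *
  have hJ' : #(altCycles (joinOn S) (t + 3)) < n ^ (2 * t + 5) := by
    calc _ ≤ a * n ^ (t + 3) + b * n ^ (t + 2) := hJ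
      _ ≤ a * n ^ (t + 3) + b * n ^ (t + 3) := by gcongr; omega
      _ = (a + b) * n ^ (t + 3) := by ring
      _ < n * n ^ (t + 3) := by gcongr
      _ = n ^ (t + 4) := by ring
      _ ≤ n ^ (2 * t + 5) := Nat.pow_le_pow_right hpos (by omega)
  refine hJ'.trans_le ?_
  have h3 := mul_le_mul_of_nonneg_right h1 (by positivity : (0 : ℝ) ≤ (n : ℝ) ^ (2 * t + 5))
  have e1 : c ^ ((t + 3) * (t + 3)) * (n : ℝ) * (n : ℝ) ^ (2 * t + 5) =
    c ^ ((t + 1 + 2) * (t + 1 + 2)) * (n : ℝ) ^ (2 * (t + 1) + 4) := by ring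
  have e2 : 2 * (((t + 1 : ℕ) : ℝ) + 2) ^ 2 * (n : ℝ) ^ (2 * (t + 1) + 3) =
    2 * ((t : ℝ) + 3) ^ 2 * (n : ℝ) ^ (2 * t + 5) := by push_cast; ring
  rw [e1] at h3
  rw [e2] at hd
  have h4 : (n : ℝ) ^ (2 * t + 5) ≤ #(altCycles G (t + 1 + 2)) := by linarith
  exact_mod_cast h4

lemma pow_sub_le_card_indepTuples [Fintype V] (G : SimpleGraph V) (t : ℕ) {c : ℝ}
    (h : (adjPairs G : ℝ) ≤ c * (Fintype.card V : ℝ) ^ 2) :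
    (Fintype.card V : ℝ) ^ (t + 3) - ((t : ℝ) + 3) ^ 2 * (1 + c * Fintype.card V) *
      (Fintype.card V : ℝ) ^ (t + 2) ≤ #(indepTuples G (t + 3)) := by
  have h1 : ((Fintype.card V ^ (t + 1 + 2) : ℕ) : ℝ) ≤ _ :=
    Nat.cast_le.2 (pow_le_card_indepTuples_add G (t + 1))
  push_cast at h1
  have h2 : ((t : ℝ) + 1 + 2) ^ 2 * ((Fintype.card V + adjPairs G) * (Fintype.card V : ℝ) ^ (t + 1)) ≤
      ((t : ℝ) + 1 + 2) ^ 2 * ((Fintype.card V + c * (Fintype.card V : ℝ) ^ 2) *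
        (Fintype.card V : ℝ) ^ (t + 1)) := by gcongr
  have e : ((t : ℝ) + 1 + 2) ^ 2 * ((Fintype.card V + c * (Fintype.card V : ℝ) ^ 2) *
        (Fintype.card V : ℝ) ^ (t + 1)) = ((t : ℝ) + 3) ^ 2 * (1 + c * Fintype.card V) *
      (Fintype.card V : ℝ) ^ (t + 2) := by ring
  have h3 : (Fintype.card V : ℝ) ^ (t + 1 + 2) ≤ #(indepTuples G (t + 1 + 2)) +
    ((t : ℝ) + 3) ^ 2 * (1 + c * Fintype.card V) * (Fintype.card V : ℝ) ^ (t + 2) := by linarith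
  exact sub_le_iff_le_add.2 h3

lemma card_altCycles_joinOn_lt_of_sparse [Fintype V] {G : SimpleGraph V} {S₀ : Finset V} {t : ℕ}
    {S : V → V → Finset V} (hS : IsSelection G #S₀ S) (hk : t + 3 ≤ #S₀)
    (hm : 2 * (#S₀).descFactorial (t + 3) < #S₀ ^ (t + 3)) (hn : 0 < Fintype.card V) {c ε : ℝ}
    (h : (adjPairs G : ℝ) ≤ c * (Fintype.card V : ℝ) ^ 2)
    (hε : 2 * (#S₀).descFactorial (t + 3) * (((t : ℝ) + 3) ^ 2 * (1 + c * Fintype.card V)) +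
      joinConst #S₀ t < ε * Fintype.card V)
    (hbad : ε * (Fintype.card V : ℝ) ^ (t + 3) ≤
      #((indepTuples G (t + 3)).filter fun v => S (v 0) (v 1) ≠ S (v 1) (v 2))) :
    #(altCycles (joinOn S₀) (t + 3)) < #(altCycles G (t + 3)) := by
  have h1 : ((_ : ℕ) : ℝ) ≤ _ := Nat.cast_le.2 (card_altCycles_ge_of_selection hS hk hm)
  have h2 : ((_ : ℕ) : ℝ) ≤ _ := Nat.cast_le.2 (card_altCycles_joinOn_le_add S₀ t)
  have h3 := pow_sub_le_card_indepTuples G t h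
  push_cast at h1 h2
  rw [← Nat.cast_lt (α := ℝ)]
  set n : ℝ := (Fintype.card V : ℝ)
  have hn' : 0 < n ^ (t + 2) := pow_pos (Nat.cast_pos.2 hn) _
  have h4 := mul_le_mul_of_nonneg_left h3
    (by positivity : (0 : ℝ) ≤ 2 * (#S₀).descFactorial (t + 3))
  have h5 := mul_lt_mul_of_pos_right hε hn'
  have e : ε * n * n ^ (t + 2) = ε * n ^ (t + 3) := by ring
  rw [e] at h5
  linarith

lemma lt_mul_pow_of_le {M C n y a : ℝ} {t : ℕ} (hM : 0 ≤ M) (hn : 0 < n)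
    (ha : a * (4 * (t + 3) * (M + 1)) = 1) (hC : 4 * C ≤ n) (hy : (1 - 3 * a) * n ≤ y) :
    M * n ^ (t + 2) + C * n ^ (t + 1) < (M + 1) * y ^ (t + 2) := by
  have ht : (0 : ℝ) ≤ t := Nat.cast_nonneg t
  have hpos : 0 < 4 * ((t : ℝ) + 3) * (M + 1) := by positivity
  have ha0 : 0 < a := pos_of_mul_pos_left (by rw [ha]; exact one_pos) hpos.le
  have ha1 : 3 * a ≤ 1 := by nlinarith [mul_nonneg ht hM]
  have hb : 1 - ((t : ℝ) + 2) * (3 * a) ≤ (1 - 3 * a) ^ (t + 2) := by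
    have := one_add_mul_le_pow (a := -(3 * a)) (by linarith) (t + 2)
    push_cast at this
    calc _ = 1 + ((t : ℝ) + 2) * -(3 * a) := by ring
      _ ≤ _ := this
      _ = _ := by ring
  have h1 : M + 1 / 4 < (M + 1) * (1 - 3 * a) ^ (t + 2) := by
    refine lt_of_lt_of_le ?_ (mul_le_mul_of_nonneg_left hb (by linarith))
    nlinarith [mul_pos ha0 (by linarith : 0 < M + 1)]
  have hnp : 0 < n ^ (t + 1) := pow_pos hn _
  calc M * n ^ (t + 2) + C * n ^ (t + 1) ≤ M * n ^ (t + 2) + n / 4 * n ^ (t + 1) := by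
        gcongr
        linarith
    _ = (M + 1 / 4) * n ^ (t + 2) := by ring
    _ < (M + 1) * (1 - 3 * a) ^ (t + 2) * n ^ (t + 2) := by gcongr
    _ = (M + 1) * ((1 - 3 * a) * n) ^ (t + 2) := by rw [mul_pow]; ring
    _ ≤ (M + 1) * y ^ (t + 2) := by gcongr

lemma card_altCycles_joinOn_lt_of_remainder_nonempty [Fintype V] {G : SimpleGraph V}
    {S₀ : Finset V} {t : ℕ} {S : V → V → Finset V} (hS : IsSelection G #S₀ S)
    (hk : t + 3 ≤ #S₀) (hG : G.CliqueFree (#S₀ + 2)) (hS₀ : G.IsClique S₀)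
    (hR : (remainder G S₀).Nonempty) {a : ℝ}
    (ha : a * (4 * (t + 3) * ((#S₀).descFactorial (t + 3) + 1)) = 1)
    (hRa : (#(remainder G S₀) : ℝ) ≤ a * (a / 2) ^ (t + 3) * Fintype.card V)
    (hU : (1 - a) * Fintype.card V ≤ #(commonNbrs G S₀))
    (ht : (t : ℝ) + 3 ≤ a / 2 * Fintype.card V)
    (hC : 4 * (((t : ℝ) + 3) * (#S₀ ^ 3 * (2 * #S₀) ^ (t + 1))) ≤ Fintype.card V) :
    #(altCycles (joinOn S₀) (t + 3)) < #(altCycles G (t + 3)) := by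
  have hpos : 0 < Fintype.card V := card_pos.2 (hR.mono (subset_univ _))
  refine card_altCycles_joinOn_lt hS₀ t ?_
  set B : ℕ := (#S₀).descFactorial (t + 3) * Fintype.card V ^ (t + 2) +
    (t + 3) * (#S₀ ^ 3 * (2 * #S₀ * Fintype.card V) ^ (t + 1)) with hB
  set M : ℝ := ((#S₀).descFactorial (t + 3) : ℝ) with hMdef
  have hM : 0 ≤ M := Nat.cast_nonneg _
  set n : ℝ := (Fintype.card V : ℝ) with hndef
  have hn : 0 < n := Nat.cast_pos.2 hpos
  have ht0 : (0 : ℝ) ≤ t := Nat.cast_nonneg t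
  have ha0 : 0 < a := pos_of_mul_pos_left (by rw [ha]; exact one_pos)
    (by positivity : 0 ≤ 4 * ((t : ℝ) + 3) * (M + 1))
  set C : ℝ := ((t : ℝ) + 3) * (#S₀ ^ 3 * (2 * #S₀) ^ (t + 1)) with hCdef
  have hBr : (B : ℝ) = M * n ^ (t + 2) + C * n ^ (t + 1) := by
    rw [hB, hCdef]
    push_cast
    rw [mul_pow _ (Fintype.card V : ℝ)]
    ring
  have hsub : ∀ x y : ℕ, (x : ℝ) - y ≤ (x - y : ℕ) := fun x y => by
    rw [sub_le_iff_le_add]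
    exact_mod_cast (by omega : x ≤ x - y + y)
  by_cases hbig : ∃ x ∈ remainder G S₀, a * n ≤ commonDegree G S₀ x
  · obtain ⟨x, hx, hdeg⟩ := hbig
    refine lt_of_lt_of_le ?_ (pow_le_card_meeting hk hx)
    rw [← Nat.cast_lt (α := ℝ)]
    have hd : a / 2 * n ≤ (commonDegree G S₀ x - (t + 3) : ℕ) := by
      refine le_trans ?_ (hsub _ _)
      push_cast
      linarith
    have hB1 : (B : ℝ) ≤ (M + 1) * n ^ (t + 2) := by
      rw [hBr]
      have : C * n ^ (t + 1) ≤ n * n ^ (t + 1) := by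
        gcongr
        linarith
      linarith [show n * n ^ (t + 1) = n ^ (t + 2) by ring]
    push_cast
    calc (#(remainder G S₀) : ℝ) * (2 * (t + 3) * B)
        ≤ (a * (a / 2) ^ (t + 3) * n) * (2 * (t + 3) * ((M + 1) * n ^ (t + 2))) := by gcongr
      _ = a * (4 * (t + 3) * (M + 1)) * ((1 / 2) * ((a / 2) ^ (t + 3) * n ^ (t + 3))) := by ring
      _ = (1 / 2) * ((a / 2) ^ (t + 3) * n ^ (t + 3)) := by rw [ha, one_mul]
      _ < (a / 2) ^ (t + 3) * n ^ (t + 3) := by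
          have : 0 < (a / 2) ^ (t + 3) * n ^ (t + 3) := by positivity
          linarith
      _ = (a / 2 * n) ^ (t + 3) := (mul_pow _ _ _).symm
      _ ≤ ((commonDegree G S₀ x - (t + 3) : ℕ) : ℝ) ^ (t + 3) := by gcongr
  · push Not at hbig
    refine lt_of_lt_of_le ?_ (sum_card_cyclesAt_le G S₀ t)
    have hlt : ∀ x ∈ remainder G S₀, B < #(cyclesAt G S₀ x (0 : Fin (t + 3))) := fun x hx => by
      refine lt_of_lt_of_le ?_ (le_card_cyclesAt_zero hk hG hS₀ hS hx)
      rw [← Nat.cast_lt (α := ℝ), hBr]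
      push_cast
      refine lt_mul_pow_of_le hM hn ha hC ?_
      have h1 := hsub (#(commonNbrs G S₀)) (commonDegree G S₀ x)
      have h2 := hsub (#(commonNbrs G S₀) - commonDegree G S₀ x) (t + 3)
      push_cast at h2
      have h3 := hbig x hx
      linarith [mul_pos ha0 hn]
    calc #(remainder G S₀) * (2 * (t + 3) * B) = 2 * (t + 3) * ∑ _x ∈ remainder G S₀, B := by
          rw [sum_const, smul_eq_mul]
          ring
      _ < _ := Nat.mul_lt_mul_of_pos_left (sum_lt_sum_of_nonempty hR hlt) (by omega)

lemma card_remainder_add_card_commonNbrs_le [Fintype V] (G : SimpleGraph V) (S : Finset V) :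
    #(remainder G S) + #(commonNbrs G S) ≤ Fintype.card V := by
  rw [← card_union_of_disjoint]
  · exact card_le_univ _
  · exact disjoint_left.2 fun x hx => (mem_remainder.1 hx).2

lemma exists_clique_of_few_distinct [Fintype V] {G : SimpleGraph V} {m t : ℕ}
    {S : V → V → Finset V} (hS : IsSelection G m S) (hn : 0 < Fintype.card V) {c ε : ℝ}
    (h : (adjPairs G : ℝ) ≤ c * (Fintype.card V : ℝ) ^ 2) (hε : ε < 1)
    (hc : ((t : ℝ) + 3) ^ 2 * (1 + c * Fintype.card V) ≤ ε / 2 * Fintype.card V)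
    (hbad : (#((indepTuples G (t + 3)).filter fun v => S (v 0) (v 1) ≠ S (v 1) (v 2)) : ℝ) ≤
      ε / 2 * (Fintype.card V : ℝ) ^ (t + 3)) :
    ∃ S₀ : Finset V, #S₀ = m ∧ G.IsClique S₀ ∧ (1 - ε) * Fintype.card V ≤ #(commonNbrs G S₀) := by
  have h1 := pow_sub_le_card_indepTuples G t h
  have h2 : ((_ : ℕ) : ℝ) = _ := congrArg Nat.cast (card_filter_add_card_filter_not
    (s := indepTuples G (t + 3)) fun v => S (v 0) (v 1) = S (v 1) (v 2))
  push_cast at h2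
  have hn' : (0 : ℝ) < Fintype.card V := Nat.cast_pos.2 hn
  have h3 := mul_le_mul_of_nonneg_right hc (pow_pos hn' (t + 2)).le
  have h4 : (1 - ε) * Fintype.card V * (Fintype.card V : ℝ) ^ (t + 2) ≤
      #((indepTuples G (t + 3)).filter fun v => S (v 0) (v 1) = S (v 1) (v 2)) := by
    have e : (Fintype.card V : ℝ) ^ (t + 3) = Fintype.card V * (Fintype.card V : ℝ) ^ (t + 2) := by
      ring
    rw [e] at h1 hbad
    linarith
  have hpos : 0 < #((indepTuples G (t + 3)).filter fun v => S (v 0) (v 1) = S (v 1) (v 2)) := by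
    rw [← Nat.cast_pos (α := ℝ)]
    exact lt_of_lt_of_le (mul_pos (mul_pos (by linarith) hn') (pow_pos hn' _)) h4
  obtain ⟨S₀, hc, hcl, hle⟩ := hS.exists_clique hpos
  refine ⟨S₀, hc, hcl, ?_⟩
  have h5 := h4.trans (Nat.cast_le.2 hle)
  push_cast at h5
  rw [mul_comm ((Fintype.card V : ℝ) ^ (t + 2))] at h5
  exact le_of_mul_le_mul_right h5 (pow_pos hn' _)

/-- For large `n`, a `K_{m+2}`-saturated graph has more labelled cycles than the join, unless it is
the join. -/
lemma exists_card_altCycles_joinOn_lt {m t : ℕ} (hk : t + 3 ≤ m)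
    (hm : 2 * m.descFactorial (t + 3) < m ^ (t + 3)) :
    ∃ n₀ : ℕ, ∀ n ≥ n₀, ∀ G : SimpleGraph (Fin n), KSat (m + 2) G →
      ∃ S : Finset (Fin n), #S = m ∧
        (#(altCycles (joinOn S) (t + 3)) < #(altCycles G (t + 3)) ∨ G = joinOn S) := by
  set M : ℝ := (m.descFactorial (t + 3) : ℝ) with hM
  have hM0 : 0 ≤ M := Nat.cast_nonneg _
  have ht0 : (0 : ℝ) ≤ t := Nat.cast_nonneg t
  have hpos : 0 < 4 * ((t : ℝ) + 3) * (M + 1) := by positivity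
  obtain ⟨a, ha⟩ : ∃ a : ℝ, a * (4 * (t + 3) * (M + 1)) = 1 := ⟨_, inv_mul_cancel₀ hpos.ne'⟩
  have ha0 : 0 < a := pos_of_mul_pos_left (by rw [ha]; exact one_pos) hpos.le
  have ha1 : a < 1 := by nlinarith [mul_nonneg ht0 hM0]
  obtain ⟨ε, hε⟩ : ∃ ε : ℝ, ε = a * (a / 2) ^ (t + 3) := ⟨_, rfl⟩
  have hε0 : 0 < ε := hε ▸ by positivity
  have hεa : ε ≤ a := by
    rw [hε]
    exact mul_le_of_le_one_right ha0.le (pow_le_one₀ (by linarith) (by linarith))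
  have hQ : 0 < 16 * ((t : ℝ) + 3) ^ 2 * (M + 1) := by positivity
  obtain ⟨c, hc⟩ : ∃ c : ℝ, c * (16 * (t + 3) ^ 2 * (M + 1)) = ε := ⟨_, div_mul_cancel₀ ε hQ.ne'⟩
  have hc0 : 0 < c := pos_of_mul_pos_left (by rw [hc]; exact hε0) hQ.le
  have hlarge : ∀ b C : ℝ, 0 < b → ∀ᶠ n : ℕ in Filter.atTop, C ≤ b * n := fun b C hb =>
    (tendsto_natCast_atTop_atTop.const_mul_atTop hb).eventually_ge_atTop C
  obtain ⟨n₀, hn₀⟩ := Filter.eventually_atTop.1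
    ((hlarge (c ^ ((t + 3) * (t + 3))) (2 * ((t : ℝ) + 3) ^ 2 + 1) (by positivity)).and
    ((hlarge (a / 2) (t + 3) (by positivity)).and
    ((hlarge 1 (4 * (((t : ℝ) + 3) * (m ^ 3 * (2 * m) ^ (t + 1)))) one_pos).and
    ((hlarge ε (32 * (M + 1) * ((t : ℝ) + 3) ^ 2) hε0).and
    ((hlarge ε (16 * joinConst m t) hε0).and
    (Filter.eventually_ge_atTop (2 * m.descFactorial (t + 3) + joinConst m t + 1 + m)))))))
  refine ⟨n₀, fun n hn G hG => ?_⟩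
  obtain ⟨h1, h2, h3, h4, h5, h6⟩ := hn₀ n hn
  have hcard : Fintype.card (Fin n) = n := Fintype.card_fin n
  have hnpos : 0 < Fintype.card (Fin n) := by omega
  obtain ⟨T, -, hT⟩ := exists_subset_card_eq (s := (univ : Finset (Fin n))) (n := m)
    (by rw [card_univ]; omega)
  obtain ⟨S, hS⟩ := hG.exists_isSelection
  have hn' : (0 : ℝ) < n := Nat.cast_pos.2 (by omega)
  rcases le_total (c * (n : ℝ) ^ 2) (adjPairs G) with hd | hd
  · refine ⟨T, hT, Or.inl (card_altCycles_joinOn_lt_of_dense G T t hc0.le ?_ ?_ ?_)⟩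
    · rwa [hcard]
    · rwa [hcard]
    · rw [hcard, hT]
      omega
  have hcn : c * n * (16 * (t + 3) ^ 2 * (M + 1)) = ε * n := by rw [← hc]; ring
  rcases le_total (ε / 2 * (n : ℝ) ^ (t + 3))
    #((indepTuples G (t + 3)).filter fun v => S (v 0) (v 1) ≠ S (v 1) (v 2)) with hb | hb
  · subst hT
    refine ⟨T, rfl, Or.inl (card_altCycles_joinOn_lt_of_sparse hS hk hm hnpos (c := c) (ε := ε / 2)
      (by rwa [hcard]) ?_ (by rw [hcard]; exact hb.trans_eq (by congr!)))⟩
    rw [hcard, ← hM]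
    have : 0 ≤ c * n * ((t : ℝ) + 3) ^ 2 := by positivity
    nlinarith [mul_pos hε0 hn', sq_nonneg ((t : ℝ) + 3)]
  · obtain ⟨S₀, rfl, hcl, hU⟩ := exists_clique_of_few_distinct hS hnpos (c := c) (ε := ε) (t := t)
      (by rwa [hcard]) (by linarith) (by
        rw [hcard]
        have h7 : 0 ≤ c * n * ((t : ℝ) + 3) ^ 2 * M := by positivity
        have h8 : 0 ≤ ((t : ℝ) + 3) ^ 2 * M := by positivity
        nlinarith [mul_pos hε0 hn', sq_nonneg ((t : ℝ) + 3)])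
      (by rw [hcard]; exact (le_of_eq (by congr!)).trans hb)
    refine ⟨S₀, rfl, ?_⟩
    rcases (remainder G S₀).eq_empty_or_nonempty with hR | hR
    · exact Or.inr (eq_joinOn_of_remainder_eq_empty hG.1 hcl hR)
    · have hle : ((_ : ℕ) : ℝ) ≤ _ := Nat.cast_le.2 (card_remainder_add_card_commonNbrs_le G S₀)
      push_cast at hle
      refine Or.inl (card_altCycles_joinOn_lt_of_remainder_nonempty hS hk hG.1 hcl hR ha ?_ ?_ ?_ ?_)
      · rw [← hε]
        linarith
      · refine le_trans (mul_le_mul_of_nonneg_right ?_ (Nat.cast_nonneg _)) hU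
        linarith
      · rwa [hcard]
      · rw [hcard]
        linarith

lemma nonempty_joinOn_iso_joinGraph {n m : ℕ} {S : Finset (Fin n)} (h : #S = m) :
    Nonempty (joinOn S ≃g joinGraph n (m + 2)) := by
  rw [joinGraph_eq_joinOn]
  refine nonempty_joinOn_iso (h.trans (card_filter_val_lt ?_).symm)
  simpa [h] using card_le_univ S

lemma card_altCycles_joinGraph_eq_zero {n m t : ℕ} (hn : m ≤ n) (hk : m < t + 3) :
    #(altCycles (joinGraph n (m + 2)) (t + 3)) = 0 := by
  rw [card_eq_zero, eq_empty_iff_forall_notMem, joinGraph_eq_joinOn]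
  intro p hp
  have := card_le_of_mem_altCycles_joinOn hp
  rw [card_filter_val_lt (by simpa using hn)] at this
  omega

lemma exists_card_altCycles_joinGraph_lt {m t : ℕ} (h : 4 * m ≤ (t + 3) ^ 2) (hk : t + 3 ≤ m) :
    ∃ n₀ : ℕ, ∀ n ≥ n₀, ∀ G : SimpleGraph (Fin n), KSat (m + 2) G →
      #(altCycles (joinGraph n (m + 2)) (t + 3)) < #(altCycles G (t + 3)) ∨
        Nonempty (G ≃g joinGraph n (m + 2)) := by
  obtain ⟨n₀, hn₀⟩ :=
    exists_card_altCycles_joinOn_lt hk (two_mul_descFactorial_lt (by omega) hk h)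
  refine ⟨n₀, fun n hn G hG => ?_⟩
  obtain ⟨S, hS, hlt | rfl⟩ := hn₀ n hn G hG
  · obtain ⟨e⟩ := nonempty_joinOn_iso_joinGraph hS
    exact Or.inl (card_altCycles_eq_of_iso e (t + 3) ▸ hlt)
  · exact Or.inr (nonempty_joinOn_iso_joinGraph hS)

end EvenCycles

/-- For `s ≥ 4` and even `r` with `r ≥ 4·√(s-2)`, for all sufficiently large
`n`, every `K_s`-saturated graph on `n` vertices has at least as many copies of `C_r` as the
join `K_{s-2} ∗ ∅_{n-s+2}`; moreover if in addition `r ≤ 2s - 4` then the join is the unique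
`K_s`-saturated graph attaining this minimum. -/
theorem cycles_even_min (s r : ℕ) (hs : 4 ≤ s) (heven : Even r)
    (hr : 4 * Real.sqrt ((s : ℝ) - 2) ≤ (r : ℝ)) :
    ∃ n₀ : ℕ, ∀ n ≥ n₀,
      (∀ G : SimpleGraph (Fin n), KSat s G →
        cycleCount (joinGraph n s) r ≤ cycleCount G r) ∧
      (r ≤ 2 * s - 4 →
        ∀ G : SimpleGraph (Fin n), KSat s G →
          cycleCount G r = cycleCount (joinGraph n s) r → Nonempty (G ≃g joinGraph n s)) := by
  obtain ⟨m, rfl⟩ : ∃ m, s = m + 2 := ⟨s - 2, by omega⟩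
  obtain ⟨k, rfl⟩ := heven
  have hkm : 4 * m ≤ k ^ 2 := by
    push_cast at hr
    rw [add_sub_cancel_right] at hr
    have h1 := Real.sq_sqrt (Nat.cast_nonneg (α := ℝ) m)
    have h2 : (4 * m : ℝ) ≤ (k : ℝ) ^ 2 := by nlinarith [Real.sqrt_nonneg (m : ℝ)]
    exact_mod_cast h2
  obtain ⟨t, rfl⟩ : ∃ t, k = t + 3 := by
    refine ⟨k - 3, ?_⟩
    by_contra hk
    have : k ^ 2 ≤ 2 ^ 2 := Nat.pow_le_pow_left (by omega) 2
    omega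
  rw [← mul_two]
  obtain ⟨c, hc, hcount⟩ := exists_cycleCount_mul_eq (t + 3)
  by_cases hk : t + 3 ≤ m
  · obtain ⟨n₀, hn₀⟩ := exists_card_altCycles_joinGraph_lt hkm hk
    refine ⟨n₀, fun n hn => ⟨fun G hG => ?_, fun _ G hG heq => ?_⟩⟩
    · refine Nat.le_of_mul_le_mul_right ?_ hc
      rw [hcount, hcount]
      rcases hn₀ n hn G hG with h | ⟨⟨e⟩⟩
      · exact h.le
      · exact (card_altCycles_eq_of_iso e (t + 3)).ge
    · refine (hn₀ n hn G hG).resolve_left fun h => ?_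
      rw [← hcount, ← hcount, heq] at h
      exact lt_irrefl _ h
  · refine ⟨m, fun n hn => ⟨fun G hG => ?_, fun hr' => by omega⟩⟩
    refine Nat.le_of_mul_le_mul_right ?_ hc
    rw [hcount, hcount, card_altCycles_joinGraph_eq_zero hn (by omega)]
    exact Nat.zero_le _
end

section
/- Let s ≥ 4 and let r be an odd integer with 5 ≤ r ≤ 2s - 4. For every function f : ℕ → ℝ with f(n) → ∞ as n → ∞, there exist a constant C > 0 and n₀ such that for all n ≥ n₀: every K_s-saturated graph on n vertices that has the minimum number of copies of C_r among all n-vertex K_s-saturated graphs has at most C·n·f(n) edges. -/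
open SimpleGraph Finset

variable {V : Type*}

/-! ### Copies of cycles and injective homomorphisms -/

lemma cycleCount_eq_copyCount [Fintype V] (G : SimpleGraph V) (r : ℕ) :
    cycleCount G r = G.copyCount (cycleGraph r) := by
  classical
  rw [cycleCount, copyCount, ← Set.ncard_coe_finset]
  congr 1
  ext H
  simp only [Set.mem_ofPred_eq, coe_filter, mem_univ, true_and]
  exact ⟨fun ⟨e⟩ ↦ ⟨e.symm⟩, fun ⟨e⟩ ↦ ⟨e.symm⟩⟩

lemma labelledCopyCount_eq_ncard {W : Type*} [Fintype V] [Fintype W] (G : SimpleGraph V)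
    (H : SimpleGraph W) :
    G.labelledCopyCount H =
      {φ : W → V | φ.Injective ∧ ∀ a b, H.Adj a b → G.Adj (φ a) (φ b)}.ncard := by
  classical
  rw [labelledCopyCount, ← Nat.card_eq_fintype_card]
  exact Nat.card_congr ⟨fun f ↦ ⟨f, f.injective, fun a b h ↦ f.toHom.map_adj h⟩,
    fun φ ↦ ⟨⟨φ.1, fun {a b} h ↦ φ.2.2 a b h⟩, φ.2.1⟩, fun f ↦ rfl, fun φ ↦ rfl⟩

lemma labelledCopyCount_le_mul_copyCount {W : Type*} [Fintype V] [Fintype W]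
    (G : SimpleGraph V) (H : SimpleGraph W) :
    G.labelledCopyCount H ≤ Fintype.card W ^ Fintype.card W * G.copyCount H := by
  classical
  rw [copyCount_eq_card_image_copyToSubgraph, labelledCopyCount, ← Finset.card_univ]
  refine card_le_mul_card_image univ _ fun H' hH' ↦ ?_
  obtain ⟨f₀, -, rfl⟩ := mem_image.1 hH'
  refine (card_le_card_of_injOn (t := Fintype.piFinset fun _ : W ↦ univ.image f₀)
    (fun f : Copy H G ↦ (f : W → V)) ?_ DFunLike.coe_injective.injOn).trans ?_
  · intro f hf
    have hverts := congrArg Subgraph.verts (mem_filter.1 hf).2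
    refine mem_coe.2 (Fintype.mem_piFinset.2 fun i ↦ ?_)
    have hi : f i ∈ f.toSubgraph.verts := ⟨i, trivial, rfl⟩
    rw [hverts] at hi
    obtain ⟨j, -, hj⟩ := hi
    exact mem_image.2 ⟨j, mem_univ j, hj⟩
  · rw [Fintype.card_piFinset, prod_const, card_image_of_injective _ (f := ⇑f₀) f₀.injective,
      Finset.card_univ]

/-! ### Ramsey and supersaturation -/

/-- Ramsey's theorem for two colours. -/
lemma exists_ramsey_bound (s t : ℕ) : ∃ N : ℕ, ∀ {α : Type} (G : SimpleGraph α) (A : Finset α),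
    N ≤ #A → (∃ T ⊆ A, G.IsNClique s T) ∨
      ∃ T ⊆ A, #T = t ∧ ∀ x ∈ T, ∀ y ∈ T, ¬ G.Adj x y := by
  classical
  induction s generalizing t with
  | zero => exact ⟨0, fun G A _ ↦ .inl ⟨∅, by simp⟩⟩
  | succ s ihs =>
    induction t with
    | zero => exact ⟨0, fun G A _ ↦ .inr ⟨∅, by simp⟩⟩
    | succ t iht =>
      obtain ⟨N₁, h₁⟩ := ihs (t + 1)
      obtain ⟨N₂, h₂⟩ := iht
      refine ⟨N₁ + N₂ + 1, fun {α} G A hA ↦ ?_⟩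
      obtain ⟨x, hx⟩ : A.Nonempty := card_pos.1 (by omega)
      have hsplit := card_filter_add_card_filter_not (s := A.erase x) (fun y ↦ G.Adj x y)
      rw [card_erase_of_mem hx] at hsplit
      by_cases hN : N₁ ≤ #{y ∈ A.erase x | G.Adj x y}
      · obtain ⟨T, hT, hc⟩ | ⟨T, hT, hc⟩ := h₁ G _ hN
        · refine .inl ⟨insert x T, ?_, hc.insert fun y hy ↦ (mem_filter.1 (hT hy)).2⟩
          exact insert_subset hx (hT.trans ((filter_subset _ _).trans (erase_subset _ _)))
        · exact .inr ⟨T, hT.trans ((filter_subset _ _).trans (erase_subset _ _)), hc⟩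
      · obtain ⟨T, hT, hc⟩ | ⟨T, hT, hc, hi⟩ := h₂ G {y ∈ A.erase x | ¬ G.Adj x y} (by omega)
        · exact .inl ⟨T, hT.trans ((filter_subset _ _).trans (erase_subset _ _)), hc⟩
        · have hx' : ∀ y ∈ T, y ≠ x ∧ ¬ G.Adj x y := fun y hy ↦ by
            have := mem_filter.1 (hT hy)
            exact ⟨(mem_erase.1 this.1).1, this.2⟩
          refine .inr ⟨insert x T, ?_, ?_, ?_⟩
          · exact insert_subset hx (hT.trans ((filter_subset _ _).trans (erase_subset _ _)))
          · rw [card_insert_of_notMem fun h ↦ (hx' x h).1 rfl, hc]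
          · intro y hy z hz
            rw [mem_insert] at hy hz
            obtain rfl | hy := hy <;> obtain rfl | hz := hz
            · exact G.irrefl
            · exact (hx' z hz).2
            · exact fun h ↦ (hx' y hy).2 h.symm
            · exact hi y hy z hz

/-- The vertices of the tuple `v` are pairwise nonadjacent. -/
def IndepTuple {ι : Type*} (G : SimpleGraph V) (v : ι → V) : Prop :=
  ∀ i j, ¬ G.Adj (v i) (v j)

lemma exists_indepTuple_comp (s k : ℕ) : ∃ R : ℕ, ∀ {V : Type} (G : SimpleGraph V),
    G.CliqueFree s → ∀ a : Fin R ↪ V, ∃ e : Fin k ↪ Fin R, IndepTuple G (a ∘ e) := by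
  obtain ⟨R, hR⟩ := exists_ramsey_bound s k
  refine ⟨R, fun {V} G hG a ↦ ?_⟩
  obtain ⟨T, -, hT⟩ | ⟨T, -, hT, hi⟩ := hR (G.comap a) univ (by simp)
  · exact absurd hT (hG.comap (Embedding.comap a G).isContained T)
  · exact ⟨(T.orderEmbOfFin hT).toEmbedding,
      fun i j ↦ hi _ (T.orderEmbOfFin_mem hT i) _ (T.orderEmbOfFin_mem hT j)⟩

/-- Supersaturation: if each `R`-tuple of distinct elements of `X` has a `k`-subtuple in `P`,
then `P` contains a positive proportion of all `k`-tuples. -/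
lemma card_pow_le_mul_ncard [Fintype V] {k R : ℕ} (X : Finset V) (hX : 2 * R ≤ #X)
    (hX0 : 0 < #X) (P : Set (Fin k → V))
    (h : ∀ a : Fin R ↪ V, (∀ i, a i ∈ X) → ∃ e : Fin k ↪ Fin R, a ∘ e ∈ P) :
    #X ^ k ≤ 2 ^ R * Fintype.card (Fin k ↪ Fin R) * P.ncard := by
  classical
  have hfiber (e : Fin k ↪ Fin R) :
      #{a : Fin R ↪ X | (fun i ↦ (a (e i) : V)) ∈ P} ≤ P.ncard * #X ^ (R - k) := by
    have hinj : Set.InjOn (fun a : Fin R ↪ X ↦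
        ((fun i ↦ (a (e i) : V)), fun i : {i // i ∉ Set.range e} ↦ a i))
        ({a : Fin R ↪ X | (fun i ↦ (a (e i) : V)) ∈ P} : Finset _) := by
      intro a _ b _ hab
      simp only [Prod.mk.injEq] at hab
      ext i
      by_cases hi : i ∈ Set.range e
      · obtain ⟨j, rfl⟩ := hi
        exact congrFun hab.1 j
      · exact congrArg Subtype.val (congrFun hab.2 ⟨i, hi⟩)
    refine (card_le_card_of_injOn (t := P.toFinset ×ˢ univ) _ ?_ hinj).trans ?_
    · intro a ha
      simpa using ha
    · rw [card_product, Set.ncard_eq_toFinset_card', card_univ, Fintype.card_fun,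
        Fintype.card_coe, Fintype.card_subtype_compl, Fintype.card_fin,
        Fintype.card_congr (Equiv.ofInjective e e.injective).symm, Fintype.card_fin]
  have hcover : (#X).descFactorial R ≤
      Fintype.card (Fin k ↪ Fin R) * (P.ncard * #X ^ (R - k)) := by
    calc (#X).descFactorial R = #(univ : Finset (Fin R ↪ X)) := by
          rw [card_univ, Fintype.card_embedding_eq]; simp
      _ ≤ #((univ : Finset (Fin k ↪ Fin R)).biUnion
            fun e ↦ {a : Fin R ↪ X | (fun i ↦ (a (e i) : V)) ∈ P}) := by
          refine card_le_card fun a _ ↦ ?_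
          obtain ⟨e, he⟩ := h (a.trans (Function.Embedding.subtype _)) fun i ↦ (a i).2
          simp only [mem_biUnion, mem_univ, true_and, mem_filter]
          exact ⟨e, he⟩
      _ ≤ _ := by
          refine (card_biUnion_le_card_mul _ _ _ fun e _ ↦ hfiber e).trans ?_
          rw [card_univ]
  have hk : k ≤ R := by
    have hpos : 0 < (#X).descFactorial R := Nat.descFactorial_pos.2 (by omega)
    have : 0 < Fintype.card (Fin k ↪ Fin R) := Nat.pos_of_mul_pos_right (hpos.trans_le hcover)
    obtain ⟨e⟩ := Fintype.card_pos_iff.1 this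
    simpa using Fintype.card_le_of_embedding e
  refine Nat.le_of_mul_le_mul_right ?_ (pow_pos hX0 (R - k))
  calc #X ^ k * #X ^ (R - k) = #X ^ R := by rw [← pow_add]; congr 1; omega
    _ ≤ (2 * (#X + 1 - R)) ^ R := Nat.pow_le_pow_left (by omega) _
    _ ≤ 2 ^ R * (#X).descFactorial R := by
        rw [mul_pow]; exact Nat.mul_le_mul_left _ (Nat.pow_sub_le_descFactorial _ _)
    _ ≤ 2 ^ R * (Fintype.card (Fin k ↪ Fin R) * (P.ncard * #X ^ (R - k))) :=
        Nat.mul_le_mul_left _ hcover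
    _ = _ := by ring

/-! ### Building odd cycles in saturated graphs -/

/-- The injective homomorphisms from the cycle `C_r` to `G`. -/
def cycleEmbeddings (G : SimpleGraph V) (r : ℕ) : Set (Fin r → V) :=
  {φ | φ.Injective ∧ ∀ i j, (cycleGraph r).Adj i j → G.Adj (φ i) (φ j)}

/-- The position `2 i` of the cycle `C_{2m+3}`. -/
def evenPos {m : ℕ} (i : Fin (m + 2)) : Fin (2 * m + 3) := ⟨2 * i, by omega⟩

/-- The position `2 i + 1` of the cycle `C_{2m+3}`. -/
def oddPos {m : ℕ} (i : Fin (m + 1)) : Fin (2 * m + 3) := ⟨2 * i + 1, by omega⟩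

lemma exists_cycleEmbedding {m : ℕ} (G : SimpleGraph V) (a : Fin (m + 2) → V)
    (b : Fin (m + 1) → V) (ha : a.Injective) (hb : b.Injective) (hab : ∀ i j, b i ≠ a j)
    (hadj : ∀ i : Fin (m + 1), G.Adj (a i.castSucc) (b i) ∧ G.Adj (b i) (a i.succ))
    (hlast : G.Adj (a (Fin.last _)) (a 0)) :
    ∃ φ ∈ cycleEmbeddings G (2 * m + 3),
      (∀ i, φ (evenPos i) = a i) ∧ ∀ i, φ (oddPos i) = b i := by
  let φ : Fin (2 * m + 3) → V := fun j ↦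
    if h : (j : ℕ) % 2 = 0 then a ⟨j / 2, by omega⟩ else b ⟨j / 2, by omega⟩
  have he (i : Fin (m + 2)) : φ (evenPos i) = a i := by
    simp [φ, evenPos]
  have ho (i : Fin (m + 1)) : φ (oddPos i) = b i := by
    have : (2 * (i : ℕ) + 1) / 2 = i := by omega
    simp [φ, oddPos, Nat.add_mod, this]
  have hcases (j : Fin (2 * m + 3)) : (∃ i, j = evenPos i) ∨ ∃ i, j = oddPos i := by
    obtain h | h := Nat.mod_two_eq_zero_or_one j
    · exact .inl ⟨⟨j / 2, by omega⟩, Fin.ext (by simp only [evenPos]; omega)⟩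
    · exact .inr ⟨⟨j / 2, by omega⟩, Fin.ext (by simp only [oddPos]; omega)⟩
  have hsucc (j : Fin (2 * m + 3)) : G.Adj (φ j) (φ (j + 1)) := by
    obtain ⟨i, rfl⟩ | ⟨i, rfl⟩ := hcases j
    · obtain ⟨i, rfl⟩ | rfl := i.eq_castSucc_or_eq_last
      · have : evenPos i.castSucc + 1 = oddPos i := by
          apply Fin.ext
          rw [Fin.val_add_one_of_lt (by simp [Fin.lt_def, evenPos]; omega)]
          simp [evenPos, oddPos]
        rw [this, he, ho]
        exact (hadj i).1
      · have : evenPos (Fin.last (m + 1)) + 1 = evenPos 0 := by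
          have : evenPos (Fin.last (m + 1)) = Fin.last (2 * m + 2) := by
            apply Fin.ext; simp [evenPos]; omega
          rw [this, Fin.last_add_one]
          rfl
        rw [this, he, he]
        exact hlast
    · have : oddPos i + 1 = evenPos i.succ := by
        apply Fin.ext
        rw [Fin.val_add_one_of_lt (by simp [Fin.lt_def, oddPos]; omega)]
        simp [evenPos, oddPos]; omega
      rw [this, he, ho]
      exact (hadj i).2
  refine ⟨φ, ⟨?_, ?_⟩, he, ho⟩
  · intro x y hxy
    obtain ⟨i, rfl⟩ | ⟨i, rfl⟩ := hcases x <;> obtain ⟨j, rfl⟩ | ⟨j, rfl⟩ := hcases y <;>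
      simp only [he, ho] at hxy
    · rw [ha hxy]
    · exact absurd hxy.symm (hab _ _)
    · exact absurd hxy (hab _ _)
    · rw [hb hxy]
  · intro i j hij
    obtain h | h := (cycleGraph_adj (n := 2 * m + 1)).1 hij
    · rw [sub_eq_iff_eq_add'.1 h, add_comm]
      simpa [add_comm] using (hsucc j).symm
    · rw [sub_eq_iff_eq_add'.1 h]
      exact hsucc i

lemma exists_injective_mem {q : ℕ} (T : Fin q → Finset V) (hT : ∀ i, q ≤ #(T i)) :
    ∃ b : Fin q → V, b.Injective ∧ ∀ i, b i ∈ T i := by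
  classical
  refine (all_card_le_biUnion_card_iff_exists_injective T).1 fun S ↦ ?_
  obtain rfl | ⟨i, hi⟩ := S.eq_empty_or_nonempty
  · simp
  · calc #S ≤ q := by simpa using card_le_univ S
      _ ≤ #(T i) := hT i
      _ ≤ _ := card_le_card (subset_biUnion_of_mem T hi)

lemma KSat.exists_common_clique {s : ℕ} {G : SimpleGraph V} (hG : KSat s G) {u v : V}
    (huv : u ≠ v) (hadj : ¬ G.Adj u v) :
    ∃ T : Finset V, G.IsNClique (s - 2) T ∧ ∀ w ∈ T, G.Adj u w ∧ G.Adj v w := by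
  classical
  have h := hG.2 u v huv hadj
  change ¬ (G ⊔ edge u v).CliqueFree s at h
  simp only [CliqueFree, not_forall, not_not] at h
  obtain ⟨t, ht⟩ := h
  have hu : u ∈ t := hG.1.mem_of_sup_edge_isNClique ht
  have ht' : (G ⊔ edge v u).IsNClique s t := edge_comm u v ▸ ht
  have hv : v ∈ t := hG.1.mem_of_sup_edge_isNClique ht'
  have hcu := ht.erase_of_sup_edge_of_mem hu
  have hcv := ht'.erase_of_sup_edge_of_mem hv
  have hvu : v ∈ t.erase u := mem_erase.2 ⟨huv.symm, hv⟩
  refine ⟨(t.erase u).erase v, ⟨hcu.1.subset (by simp), ?_⟩, fun w hw ↦ ?_⟩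
  · rw [card_erase_of_mem hvu, hcu.2]; omega
  · simp only [mem_erase] at hw
    exact ⟨hcv.1 (by simp [huv, hu]) (by simp [hw]) (Ne.symm hw.2.1),
      hcu.1 (by simp [huv.symm, hv]) (by simp [hw]) (Ne.symm hw.1)⟩

lemma KSat.exists_cycleEmbedding_of_edge {s m : ℕ} {G : SimpleGraph V} (hG : KSat s G)
    (hm : m + 3 ≤ s) (hm1 : 1 ≤ m) (a : Fin (m + 2) → V) (ha : a.Injective)
    (hedge : G.Adj (a (Fin.last _)) (a 0))
    (hnon : ∀ i j, i < j → G.Adj (a i) (a j) → i = 0 ∧ j = Fin.last _) :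
    ∃ φ ∈ cycleEmbeddings G (2 * m + 3), ∀ i, φ (evenPos i) = a i := by
  have hclique (i : Fin (m + 1)) : ∃ T : Finset V, G.IsNClique (s - 2) T ∧
      ∀ w ∈ T, G.Adj (a i.castSucc) w ∧ G.Adj (a i.succ) w := by
    refine hG.exists_common_clique (ha.ne i.castSucc_lt_succ.ne) fun h ↦ ?_
    have := hnon _ _ i.castSucc_lt_succ h
    simp only [Fin.ext_iff, Fin.val_castSucc, Fin.val_succ, Fin.val_zero, Fin.val_last] at this
    omega
  choose T hT hTadj using hclique
  obtain ⟨b, hb, hbT⟩ := exists_injective_mem T fun i ↦ by rw [(hT i).2]; omega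
  have hab (i j) : b i ≠ a j := by
    intro hij
    have hsymm (i j : Fin (m + 2)) (h : G.Adj (a i) (a j)) :
        (i = 0 ∧ j = Fin.last _) ∨ (j = 0 ∧ i = Fin.last _) := by
      obtain hlt | heq | hlt := lt_trichotomy i j
      · exact .inl (hnon i j hlt h)
      · exact absurd h (heq ▸ G.irrefl)
      · exact .inr (hnon j i hlt h.symm)
    have h := hTadj i _ (hbT i)
    rw [hij] at h
    have h₁ := hsymm _ _ h.1
    have h₂ := hsymm _ _ h.2
    simp only [Fin.ext_iff, Fin.val_castSucc, Fin.val_succ, Fin.val_zero, Fin.val_last] at h₁ h₂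
    omega
  obtain ⟨φ, hφ, he, -⟩ := exists_cycleEmbedding G a b ha hb hab
    (fun i ↦ ⟨(hTadj i _ (hbT i)).1, (hTadj i _ (hbT i)).2.symm⟩) hedge
  exact ⟨φ, hφ, he⟩

lemma KSat.exists_cycleEmbedding_of_indepTuple {s m : ℕ} {G : SimpleGraph V} (hG : KSat s G)
    (hm : m + 4 ≤ s) (hm1 : 1 ≤ m) (v : Fin (m + 1) → V) (hv : v.Injective)
    (hnon : IndepTuple G v) :
    ∃ U : Finset V, #U ≤ m + 2 ∧ ∀ w ∉ U, G.Adj (v 0) w → G.Adj (v 1) w →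
      ∃ φ ∈ cycleEmbeddings G (2 * m + 3),
        (∀ i : Fin (m + 1), φ (evenPos i.castSucc) = v i) ∧ φ (oddPos 0) = w := by
  classical
  have hclique (i : Fin (m + 1)) : ∃ T : Finset V, G.IsNClique (s - 2) T ∧
      ∀ w ∈ T, G.Adj (v i) w ∧ G.Adj (v (i + 1)) w := by
    refine hG.exists_common_clique (hv.ne fun h ↦ ?_) (hnon _ _)
    have : Fact (1 < m + 1) := ⟨by omega⟩
    simp at h
    omega
  choose T hT hTadj using hclique
  let T' : Fin (m + 2) → Finset V := Fin.snoc T (T (Fin.last m))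
  obtain ⟨u, hu, huT⟩ := exists_injective_mem T' fun i ↦ by
    obtain ⟨i, rfl⟩ | rfl := i.eq_castSucc_or_eq_last
    · simp only [T', Fin.snoc_castSucc, (hT i).2]; omega
    · simp only [T', Fin.snoc_last, (hT _).2]; omega
  have hu₁ (i : Fin (m + 1)) : u i.castSucc ∈ T i := by simpa [T'] using huT i.castSucc
  have hu₂ : u (Fin.last _) ∈ T (Fin.last m) := by simpa [T'] using huT (Fin.last _)
  refine ⟨univ.image u, by simpa using card_image_le (s := univ) (f := u), fun w hw hw₀ hw₁ ↦ ?_⟩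
  have hwu (i) : u i ≠ w := fun h ↦ hw (mem_image.2 ⟨i, mem_univ _, h⟩)
  have hlast0 : Fin.last m ≠ 0 := by simp [Fin.ext_iff]; omega
  have huv (x : V) (i : Fin (m + 1)) (h : G.Adj (v i) x) (j) : x ≠ v j :=
    fun hx ↦ hnon i j (hx ▸ h)
  let a : Fin (m + 2) → V := Fin.snoc v (u (Fin.last _))
  let b : Fin (m + 1) → V := Function.update (fun i ↦ u i.castSucc) 0 w
  have hbadj (i : Fin (m + 1)) : G.Adj (v i) (b i) ∧ G.Adj (v (i + 1)) (b i) := by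
    by_cases hi : i = 0
    · subst hi
      simpa [b] using ⟨hw₀, hw₁⟩
    · simpa [b, hi] using hTadj i _ (hu₁ i)
  have hul := hTadj _ _ hu₂
  rw [Fin.last_add_one] at hul
  have ha : a.Injective := by
    refine Fin.snoc_injective_iff.2 ⟨hv, ?_⟩
    rintro ⟨j, hj⟩
    exact huv _ _ hul.1 j hj.symm
  have hb : b.Injective := by
    intro i j hij
    by_cases hi : i = 0 <;> by_cases hj : j = 0
    · rw [hi, hj]
    · simp [b, hi, hj] at hij
      exact absurd hij.symm (hwu _)
    · simp [b, hi, hj] at hij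
      exact absurd hij (hwu _)
    · simp [b, hi, hj] at hij
      exact Fin.castSucc_injective _ (hu hij)
  have hab (i j) : b i ≠ a j := by
    obtain ⟨j, rfl⟩ | rfl := j.eq_castSucc_or_eq_last
    · simpa [a] using huv _ _ (hbadj i).1 j
    · by_cases hi : i = 0
      · subst hi
        simpa [a, b] using (hwu _).symm
      · simpa [a, b, hi] using hu.ne (i.castSucc_lt_last).ne
  have hcyc (i : Fin (m + 1)) : G.Adj (a i.castSucc) (b i) ∧ G.Adj (b i) (a i.succ) := by
    refine ⟨by simpa [a] using (hbadj i).1, ?_⟩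
    obtain ⟨i, rfl⟩ | rfl := i.eq_castSucc_or_eq_last
    · have : a i.succ.castSucc = v i.succ := Fin.snoc_castSucc ..
      rw [Fin.succ_castSucc, this]
      simpa using (hbadj i.castSucc).2.symm
    · simp only [a, b, Fin.succ_last, Fin.snoc_last, Function.update_of_ne hlast0]
      exact (hT (Fin.last m)).1 (hu₁ _) hu₂ (hu.ne (Fin.castSucc_lt_last _).ne)
  have hclose : G.Adj (a (Fin.last _)) (a 0) := by
    have : a 0 = v 0 := Fin.snoc_castSucc (α := fun _ ↦ V) _ _ 0
    simpa [this, a] using hul.2.symm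
  obtain ⟨φ, hφ, he, ho⟩ := exists_cycleEmbedding G a b ha hb hab hcyc hclose
  exact ⟨φ, hφ, fun i ↦ by simp [he, a], by simp [ho, b]⟩

/-! ### The join of a clique and an independent set -/

lemma joinGraph_adj {n s : ℕ} {i j : Fin n} :
    (joinGraph n s).Adj i j ↔ i ≠ j ∧ ((i : ℕ) < s - 2 ∨ (j : ℕ) < s - 2) := by
  simp [joinGraph]

lemma kSat_joinGraph (n : ℕ) {s : ℕ} (hs : 2 ≤ s) : KSat s (joinGraph n s) := by
  classical
  refine ⟨fun t ht ↦ ?_, fun u v huv hadj hfree ↦ ?_⟩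
  · have hcore : #(t.filter fun i : Fin n ↦ (i : ℕ) < s - 2) ≤ s - 2 := by
      refine (card_le_card_of_injOn (t := range (s - 2)) (fun i : Fin n ↦ (i : ℕ)) ?_
        Fin.val_injective.injOn).trans (card_range _).le
      intro i hi
      simpa using (mem_filter.1 hi).2
    have hrest : #(t.filter fun i : Fin n ↦ ¬ (i : ℕ) < s - 2) ≤ 1 := by
      refine card_le_one.2 fun i hi j hj ↦ ?_
      by_contra hij
      rw [mem_filter] at hi hj
      have := (joinGraph_adj.1 (ht.1 (mem_coe.2 hi.1) (mem_coe.2 hj.1) hij)).2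
      tauto
    have := card_filter_add_card_filter_not (s := t) (fun i : Fin n ↦ (i : ℕ) < s - 2)
    have := ht.2
    omega
  · simp only [joinGraph_adj, not_and, not_or] at hadj
    obtain ⟨hu, hv⟩ := hadj huv
    let core : Finset (Fin n) := {i | (i : ℕ) < s - 2}
    have hmem (x : Fin n) : x ∈ core ↔ (x : ℕ) < s - 2 := by simp [core]
    have hcore : #core = s - 2 := by
      rw [Fin.card_filter_val_lt]; omega
    refine hfree (insert u (insert v core)) ⟨?_, ?_⟩
    · intro x hx y hy hxy
      simp only [coe_insert, mem_coe, hmem, Set.mem_insert_iff] at hx hy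
      simp only [addEdge, sup_adj, joinGraph_adj, fromEdgeSet_adj, Set.mem_singleton_iff,
        Sym2.eq_iff]
      grind
    · rw [card_insert_of_notMem (by simp [huv, hmem, hu]),
        card_insert_of_notMem (by simp [hmem, hv]), hcore]
      omega

lemma card_le_of_not_adj_cycleGraph {m : ℕ} (I : Finset (Fin (2 * m + 3)))
    (hI : ∀ i ∈ I, ∀ j ∈ I, ¬ (cycleGraph (2 * m + 3)).Adj i j) : #I ≤ m + 1 := by
  classical
  have hdisj : Disjoint I (I.image (· + 1)) := by
    refine disjoint_left.2 fun j hj hj' ↦ ?_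
    obtain ⟨i, hi, rfl⟩ := mem_image.1 hj'
    exact hI i hi _ hj ((cycleGraph_adj (n := 2 * m + 1)).2 (.inr (by simp)))
  have := card_le_univ (I ∪ I.image (· + 1))
  rw [card_union_of_disjoint hdisj, card_image_of_injective _ (add_left_injective 1),
    Fintype.card_fin] at this
  omega

lemma ncard_cycleEmbeddings_joinGraph_le {n s m : ℕ} (hn : 1 ≤ n) (hs : 2 ≤ s) :
    (cycleEmbeddings (joinGraph n s) (2 * m + 3)).ncard ≤
      2 ^ (2 * m + 3) * s ^ (2 * m + 3) * n ^ (m + 1) := by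
  classical
  let core : Finset (Fin n) := {i | (i : ℕ) < s - 2}
  have hcore : #core ≤ s := by
    rw [Fin.card_filter_val_lt]; omega
  let F (I : Finset (Fin (2 * m + 3))) : Finset (Fin (2 * m + 3) → Fin n) :=
    Fintype.piFinset fun i ↦ if i ∈ I then univ else core
  have hsub : cycleEmbeddings (joinGraph n s) (2 * m + 3) ⊆
      (((univ : Finset (Finset (Fin (2 * m + 3)))).filter (#· ≤ m + 1)).biUnion F : Finset _) := by
    rintro φ ⟨hinj, hφ⟩
    simp only [coe_biUnion, Set.mem_iUnion]
    refine ⟨({i | ¬ (φ i : ℕ) < s - 2} : Finset _), ?_, ?_⟩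
    · simp only [coe_filter, mem_univ, true_and, Set.mem_ofPred_eq]
      refine card_le_of_not_adj_cycleGraph _ fun i hi j hj hij ↦ ?_
      have := (joinGraph_adj.1 (hφ i j hij)).2
      simp only [mem_filter, mem_univ, true_and] at hi hj
      tauto
    · refine mem_coe.2 (Fintype.mem_piFinset.2 fun i ↦ ?_)
      simp only [mem_filter, mem_univ, true_and]
      split_ifs with hi
      · simpa [core] using hi
      · exact mem_univ _
  have hF (I : Finset (Fin (2 * m + 3))) (hI : #I ≤ m + 1) :
      #(F I) ≤ s ^ (2 * m + 3) * n ^ (m + 1) := by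
    rw [Fintype.card_piFinset]
    simp only [apply_ite card, card_univ, Fintype.card_fin]
    rw [prod_ite, prod_const, prod_const, mul_comm]
    refine Nat.mul_le_mul ((Nat.pow_le_pow_left hcore _).trans
      (Nat.pow_le_pow_right (by omega) ?_)) (Nat.pow_le_pow_right hn ?_)
    · exact (card_filter_le _ _).trans (by simp)
    · simp [hI]
  refine (Set.ncard_le_ncard hsub (finite_toSet _)).trans ?_
  rw [Set.ncard_coe_finset]
  refine (card_biUnion_le_card_mul _ _ _ fun I hI ↦ hF I (mem_filter.1 hI).2).trans ?_
  rw [mul_assoc]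
  refine Nat.mul_le_mul_right _ ((card_filter_le _ _).trans ?_)
  simp

/-! ### Counting odd cycles in saturated graphs -/

lemma exists_ne_le_card_inter {α ι : Type*} [DecidableEq α] [Fintype ι] (H : Finset α)
    (N : ι → Finset α) (hN : ∀ i, N i ⊆ H) (hcard : ∀ i, #H ≤ 8 * #(N i))
    (hι : 16 ≤ Fintype.card ι) (L : ℕ) (hL : Fintype.card ι ^ 2 * L < #H) :
    ∃ i j, i ≠ j ∧ L ≤ #(N i ∩ N j) := by
  classical
  by_contra! hlt
  have hdouble {β : Type _} (S : Finset β) (f : β → Finset α) (hf : ∀ i, f i ⊆ H) :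
      ∑ i ∈ S, #(f i) = ∑ y ∈ H, #{i ∈ S | y ∈ f i} := by
    have hf' (i : β) : #(f i) = ∑ y ∈ H, if y ∈ f i then 1 else 0 := by
      rw [← card_filter, filter_mem_eq_inter, inter_eq_right.2 (hf i)]
    simp only [hf', card_filter]
    exact sum_comm
  have hpoint (y : α) : #{i : ι | y ∈ N i} ≤
      1 + #{p ∈ (univ : Finset ι).offDiag | y ∈ N p.1 ∩ N p.2} := by
    set A : Finset ι := {i : ι | y ∈ N i}
    have hsub : A.offDiag ⊆ {p ∈ (univ : Finset ι).offDiag | y ∈ N p.1 ∩ N p.2} := by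
      intro p hp
      simp only [A, mem_offDiag, mem_filter, mem_univ, true_and, mem_inter] at hp ⊢
      exact ⟨hp.2.2, hp.1, hp.2.1⟩
    have h₁ := card_le_card hsub
    rw [offDiag_card] at h₁
    obtain h | h := Nat.lt_or_ge #A 2
    · omega
    · have : 2 * #A ≤ #A * #A := Nat.mul_le_mul_right _ h
      omega
  have hupper : ∑ i, #(N i) ≤ #H + Fintype.card ι ^ 2 * L := by
    calc ∑ i, #(N i) = ∑ y ∈ H, #{i : ι | y ∈ N i} := hdouble univ N hN
      _ ≤ ∑ y ∈ H, (1 + #{p ∈ (univ : Finset ι).offDiag | y ∈ N p.1 ∩ N p.2}) :=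
        sum_le_sum fun y _ ↦ hpoint y
      _ = #H + ∑ p ∈ (univ : Finset ι).offDiag, #(N p.1 ∩ N p.2) := by
        rw [sum_add_distrib, hdouble _ (fun p : ι × ι ↦ N p.1 ∩ N p.2)
          fun p ↦ inter_subset_left.trans (hN _)]
        simp
      _ ≤ #H + #(univ : Finset ι).offDiag * L :=
        Nat.add_le_add_left (sum_le_card_nsmul _ _ _ fun p hp ↦
          (hlt _ _ (mem_offDiag.1 hp).2.2).le) _
      _ ≤ _ := by
        rw [offDiag_card, card_univ, sq]
        exact Nat.add_le_add_left (Nat.mul_le_mul_right _ (Nat.sub_le _ _)) _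
  have hlower : 16 * #H ≤ 8 * ∑ i, #(N i) := by
    calc 16 * #H ≤ Fintype.card ι * #H := Nat.mul_le_mul_right _ hι
      _ = ∑ _i : ι, #H := by simp
      _ ≤ ∑ i, 8 * #(N i) := sum_le_sum fun i _ ↦ hcard i
      _ = _ := (mul_sum ..).symm
  omega

lemma exists_embedding_zero_one {m q : ℕ} (hm : 1 ≤ m) (hq : m + 1 ≤ q) {i j : Fin q}
    (hij : i ≠ j) : ∃ e : Fin (m + 1) ↪ Fin q, e 0 = i ∧ e 1 = j := by
  let z : Fin q := ⟨0, by omega⟩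
  let o : Fin q := ⟨1, by omega⟩
  have hzo : z ≠ o := by simp [z, o]
  let σ : Equiv.Perm (Fin q) := (Equiv.swap o (Equiv.swap z i j)).trans (Equiv.swap z i)
  have hz : z ≠ Equiv.swap z i j := by
    intro h
    have := congrArg (Equiv.swap z i) h
    simp at this
    exact hij this
  have : (1 : Fin (m + 1)).val = 1 := by
    rw [Fin.val_one', Nat.mod_eq_of_lt (by omega)]
  refine ⟨(Fin.castLEEmb hq).trans σ.toEmbedding, ?_, ?_⟩
  · change σ z = i
    simp [σ, Equiv.swap_apply_of_ne_of_ne hzo hz]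
  · have ho : Fin.castLE hq 1 = o := Fin.ext this
    change σ (Fin.castLE hq 1) = j
    rw [ho]
    simp [σ]

/-- Each edge between vertices of small degree lies on many odd cycles. -/
lemma exists_card_mul_pow_le_ncard_cycleEmbeddings (s m : ℕ) (hm : m + 3 ≤ s) (hm1 : 1 ≤ m) :
    ∃ D n₀ : ℕ, ∀ n ≥ n₀, ∀ (G : SimpleGraph (Fin n)) [DecidableRel G.Adj], KSat s G →
      #{p : Fin n × Fin n | G.Adj p.1 p.2 ∧ 4 * G.degree p.1 < n ∧ 4 * G.degree p.2 < n} * n ^ m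
        ≤ D * (cycleEmbeddings G (2 * m + 3)).ncard := by
  classical
  obtain ⟨R, hR⟩ := exists_indepTuple_comp s m
  refine ⟨2 ^ m * (2 ^ R * Fintype.card (Fin m ↪ Fin R)), 4 * R + 2, fun n hn G _ hG ↦ ?_⟩
  set E : Finset (Fin n × Fin n) :=
    {p | G.Adj p.1 p.2 ∧ 4 * G.degree p.1 < n ∧ 4 * G.degree p.2 < n} with hE
  let X (p : Fin n × Fin n) : Finset (Fin n) := (G.neighborFinset p.1 ∪ G.neighborFinset p.2)ᶜ
  let P (p : Fin n × Fin n) : Set (Fin m → Fin n) :=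
    {v | v.Injective ∧ IndepTuple G v ∧ ∀ i, v i ∈ X p}
  have hP (p) (hp : p ∈ E) :
      n ^ m ≤ 2 ^ m * (2 ^ R * Fintype.card (Fin m ↪ Fin R)) * #(P p).toFinset := by
    have hX : n ≤ 2 * #(X p) := by
      have h₁ := card_union_le (G.neighborFinset p.1) (G.neighborFinset p.2)
      have h₂ := (mem_filter.1 hp).2.2
      rw [← card_neighborFinset_eq_degree, ← card_neighborFinset_eq_degree] at h₂
      rw [card_compl, Fintype.card_fin]
      omega
    have := card_pow_le_mul_ncard (R := R) (X p) (by omega) (by omega) (P p) fun a ha ↦ by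
      obtain ⟨e, he⟩ := hR G hG.1 a
      exact ⟨e, a.injective.comp e.injective, he, fun i ↦ ha _⟩
    rw [Set.ncard_eq_toFinset_card'] at this
    calc n ^ m ≤ (2 * #(X p)) ^ m := Nat.pow_le_pow_left hX _
      _ = 2 ^ m * #(X p) ^ m := mul_pow ..
      _ ≤ 2 ^ m * (2 ^ R * Fintype.card (Fin m ↪ Fin R) * #(P p).toFinset) :=
        Nat.mul_le_mul_left _ this
      _ = _ := by ring
  have hsurj : #(E.sigma fun p ↦ (P p).toFinset) ≤
      #(cycleEmbeddings G (2 * m + 3)).toFinset := by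
    refine card_le_card_of_surjOn (fun φ ↦
      ⟨(φ (evenPos 0), φ (evenPos (Fin.last _))), fun i ↦ φ (evenPos i.castSucc.succ)⟩) ?_
    rintro ⟨⟨x, y⟩, v⟩ hv
    simp only [coe_sigma, Set.mem_sigma_iff, mem_coe, Set.mem_toFinset] at hv
    obtain ⟨hxy, hinj, hind, hvX⟩ := hv
    have hxy := (mem_filter.1 hxy).2.1
    simp only [X, mem_compl, mem_union, mem_neighborFinset, not_or] at hvX hxy
    have ha : (Fin.cons x (Fin.snoc v y : Fin (m + 1) → Fin n) : Fin (m + 2) → Fin n).Injective := by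
      refine Fin.cons_injective_iff.2 ⟨?_, Fin.snoc_injective_iff.2 ⟨hinj, ?_⟩⟩
      · rintro ⟨i, hi⟩
        obtain ⟨i, rfl⟩ | rfl := i.eq_castSucc_or_eq_last
        · rw [Fin.snoc_castSucc] at hi
          exact (hvX i).2 (hi ▸ hxy.symm)
        · rw [Fin.snoc_last] at hi
          exact hxy.ne hi.symm
      · rintro ⟨i, hi⟩
        exact (hvX i).1 (hi ▸ hxy)
    obtain ⟨φ, hφ, he⟩ := hG.exists_cycleEmbedding_of_edge hm hm1 _ ha
      (by simpa [← Fin.succ_last] using hxy.symm) (by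
        intro i j hij hadj
        obtain ⟨j, rfl⟩ := Fin.exists_succ_eq.2 (Fin.ne_zero_of_lt hij)
        obtain rfl | ⟨i, rfl⟩ := i.eq_zero_or_eq_succ
        · obtain ⟨j, rfl⟩ | rfl := j.eq_castSucc_or_eq_last
          · simp only [Fin.cons_zero, Fin.cons_succ, Fin.snoc_castSucc] at hadj
            exact absurd hadj (hvX j).1
          · exact ⟨rfl, rfl⟩
        · rw [Fin.succ_lt_succ_iff] at hij
          obtain ⟨i, rfl⟩ | rfl := i.eq_castSucc_or_eq_last
          · obtain ⟨j, rfl⟩ | rfl := j.eq_castSucc_or_eq_last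
            · simp only [Fin.cons_succ, Fin.snoc_castSucc] at hadj
              exact absurd hadj (hind i j)
            · simp only [Fin.cons_succ, Fin.snoc_castSucc, Fin.snoc_last] at hadj
              exact absurd hadj.symm (hvX i).2
          · exact absurd hij (Fin.le_last j).not_gt)
    refine ⟨φ, by simpa using hφ, ?_⟩
    simp only [he]
    simp [← Fin.succ_last]
  rw [card_sigma, ← Set.ncard_eq_toFinset_card'] at hsurj
  calc #E * n ^ m = ∑ _p ∈ E, n ^ m := by simp
    _ ≤ ∑ p ∈ E, _ := sum_le_sum hP
    _ = _ * ∑ p ∈ E, #(P p).toFinset := (mul_sum ..).symm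
    _ ≤ _ := Nat.mul_le_mul_left _ hsurj

/-- Many vertices of linear degree force many odd cycles. -/
lemma exists_mul_pow_le_ncard_cycleEmbeddings (s m : ℕ) (hm : m + 4 ≤ s) (hm1 : 1 ≤ m) :
    ∃ D : ℕ, ∀ L : ℕ, ∃ h₀ n₀ : ℕ, ∀ n ≥ n₀, ∀ (G : SimpleGraph (Fin n)) [DecidableRel G.Adj],
      KSat s G → h₀ ≤ #{v | n ≤ 4 * G.degree v} →
        L * n ^ (m + 1) ≤ D * (cycleEmbeddings G (2 * m + 3)).ncard := by
  classical
  obtain ⟨R, hR⟩ := exists_indepTuple_comp s (m + 17)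
  refine ⟨8 ^ (m + 1) * (2 ^ R * Fintype.card (Fin (m + 1) ↪ Fin R)), fun L ↦
    ⟨(m + 17) ^ 2 * (L + (m + 2)) + 1, 16 * R + 8, fun n hn G _ hG hhigh ↦ ?_⟩⟩
  obtain ⟨H, hHsub, hHcard⟩ := exists_subset_card_eq hhigh
  let X : Finset (Fin n) := {x | #H ≤ 8 * #{y ∈ H | G.Adj x y}}
  have hX : n ≤ 8 * #X := by
    have hdouble : ∑ x, #{y ∈ H | G.Adj x y} = ∑ y ∈ H, G.degree y := by
      simp only [← card_neighborFinset_eq_degree, neighborFinset_eq_filter, card_filter]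
      rw [sum_comm]
      simp only [G.adj_comm]
    have hlower : #H * n ≤ 4 * ∑ y ∈ H, G.degree y := by
      rw [mul_sum, ← smul_eq_mul, ← sum_const]
      exact sum_le_sum fun y hy ↦ (mem_filter.1 (hHsub hy)).2
    have hupper : 8 * ∑ x, #{y ∈ H | G.Adj x y} ≤ 8 * #H * #X + #H * n := by
      calc 8 * ∑ x, #{y ∈ H | G.Adj x y}
          ≤ ∑ x, ((if x ∈ X then 8 * #H else 0) + #H) := by
            rw [mul_sum]
            refine sum_le_sum fun x _ ↦ ?_
            have h₁ : #{y ∈ H | G.Adj x y} ≤ #H := card_filter_le _ _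
            split_ifs with hx
            · omega
            · simp only [X, mem_filter, mem_univ, true_and] at hx
              omega
        _ = _ := by
            rw [sum_add_distrib, ← sum_filter]
            simp [mul_comm]
    rw [hdouble] at hupper
    have : #H * n ≤ #H * (8 * #X) := by nlinarith
    exact Nat.le_of_mul_le_mul_left this (by omega)
  let W (v : Fin (m + 1) → Fin n) : Finset (Fin n) := {w | G.Adj (v 0) w ∧ G.Adj (v 1) w}
  let P : Set (Fin (m + 1) → Fin n) :=
    {v | v.Injective ∧ IndepTuple G v ∧ L + (m + 2) ≤ #(W v)}
  have hP : n ^ (m + 1) ≤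
      8 ^ (m + 1) * (2 ^ R * Fintype.card (Fin (m + 1) ↪ Fin R)) * #P.toFinset := by
    have := card_pow_le_mul_ncard (R := R) X (by omega) (by omega) P fun a ha ↦ by
      obtain ⟨e, he⟩ := hR G hG.1 a
      obtain ⟨i, j, hij, hcodeg⟩ := exists_ne_le_card_inter H
        (fun i : Fin (m + 17) ↦ {y ∈ H | G.Adj (a (e i)) y}) (fun _ ↦ filter_subset _ _)
        (fun i ↦ (mem_filter.1 (ha (e i))).2) (by simp) (L + (m + 2))
        (by rw [Fintype.card_fin]; omega)
      obtain ⟨e', rfl, rfl⟩ := exists_embedding_zero_one hm1 (by omega) hij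
      refine ⟨e'.trans e, a.injective.comp (e'.trans e).injective, fun i j ↦ he _ _,
        hcodeg.trans (card_le_card fun y hy ↦ ?_)⟩
      simp only [mem_inter, mem_filter] at hy
      simpa [W] using ⟨hy.1.2, hy.2.2⟩
    rw [Set.ncard_eq_toFinset_card'] at this
    calc n ^ (m + 1) ≤ (8 * #X) ^ (m + 1) := Nat.pow_le_pow_left hX _
      _ = 8 ^ (m + 1) * #X ^ (m + 1) := mul_pow ..
      _ ≤ 8 ^ (m + 1) * (2 ^ R * Fintype.card (Fin (m + 1) ↪ Fin R) * #P.toFinset) :=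
        Nat.mul_le_mul_left _ this
      _ = _ := by ring
  have hU (v : Fin (m + 1) → Fin n) (hv : v ∈ P) :=
    hG.exists_cycleEmbedding_of_indepTuple hm hm1 v hv.1 hv.2.1
  choose! U hUcard hU using hU
  have hsurj : #(P.toFinset.sigma fun v ↦ W v \ U v) ≤
      #(cycleEmbeddings G (2 * m + 3)).toFinset := by
    refine card_le_card_of_surjOn (fun φ ↦
      ⟨fun i ↦ φ (evenPos i.castSucc), φ (oddPos 0)⟩) ?_
    rintro ⟨v, w⟩ hvw
    simp only [coe_sigma, Set.mem_sigma_iff, mem_coe, Set.mem_toFinset, mem_sdiff, W, mem_filter,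
      mem_univ, true_and] at hvw
    obtain ⟨hv, hw, hwU⟩ := hvw
    obtain ⟨φ, hφ, he, ho⟩ := hU v hv w hwU hw.1 hw.2
    exact ⟨φ, by simpa using hφ, by simp only [he, ho]⟩
  have hL : L * #P.toFinset ≤ (cycleEmbeddings G (2 * m + 3)).ncard := by
    rw [Set.ncard_eq_toFinset_card']
    refine le_trans ?_ hsurj
    rw [card_sigma, mul_comm, ← smul_eq_mul, ← sum_const]
    refine sum_le_sum fun v hv ↦ ?_
    have hv := Set.mem_toFinset.1 hv
    have h₁ := le_card_sdiff (U v) (W v)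
    have h₂ := hUcard v hv
    have h₃ := hv.2.2
    omega
  calc L * n ^ (m + 1) ≤ L * (_ * #P.toFinset) := Nat.mul_le_mul_left _ hP
    _ = 8 ^ (m + 1) * (2 ^ R * Fintype.card (Fin (m + 1) ↪ Fin R)) * (L * #P.toFinset) := by ring
    _ ≤ _ := Nat.mul_le_mul_left _ hL

/-- A `K_s`-saturated graph minimizing the number of odd cycles has linearly many edges. -/
lemma exists_ncard_edgeSet_le_mul (s m : ℕ) (hm : m + 4 ≤ s) (hm1 : 1 ≤ m) :
    ∃ C n₀ : ℕ, ∀ n ≥ n₀, ∀ G : SimpleGraph (Fin n), KSat s G →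
      (∀ G' : SimpleGraph (Fin n), KSat s G' →
        cycleCount G (2 * m + 3) ≤ cycleCount G' (2 * m + 3)) →
      G.edgeSet.ncard ≤ C * n := by
  classical
  obtain ⟨D₁, n₁, h₁⟩ := exists_card_mul_pow_le_ncard_cycleEmbeddings s m (by omega) hm1
  obtain ⟨D₂, h₂⟩ := exists_mul_pow_le_ncard_cycleEmbeddings s m hm hm1
  let M := (2 * m + 3) ^ (2 * m + 3) * (2 ^ (2 * m + 3) * s ^ (2 * m + 3))
  obtain ⟨h₀, n₂, h₂⟩ := h₂ (D₂ * M + 1)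
  refine ⟨D₁ * M + 2 * h₀, n₁ + n₂ + 1, fun n hn G hG hmin ↦ ?_⟩
  have hcount : (cycleEmbeddings G (2 * m + 3)).ncard ≤ M * n ^ (m + 1) := by
    calc (cycleEmbeddings G (2 * m + 3)).ncard
        = G.labelledCopyCount (cycleGraph (2 * m + 3)) := (labelledCopyCount_eq_ncard ..).symm
      _ ≤ (2 * m + 3) ^ (2 * m + 3) * cycleCount G (2 * m + 3) := by
        rw [cycleCount_eq_copyCount]
        simpa using labelledCopyCount_le_mul_copyCount G (cycleGraph (2 * m + 3))
      _ ≤ (2 * m + 3) ^ (2 * m + 3) * cycleCount (joinGraph n s) (2 * m + 3) :=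
        Nat.mul_le_mul_left _ (hmin _ (kSat_joinGraph n (by omega)))
      _ ≤ (2 * m + 3) ^ (2 * m + 3) * (2 ^ (2 * m + 3) * s ^ (2 * m + 3) * n ^ (m + 1)) := by
        refine Nat.mul_le_mul_left _ ?_
        rw [cycleCount_eq_copyCount]
        refine copyCount_le_labelledCopyCount.trans ?_
        rw [labelledCopyCount_eq_ncard]
        exact ncard_cycleEmbeddings_joinGraph_le (by omega) (by omega)
      _ = _ := by ring
  have hnpos : 0 < n := by omega
  have hhigh : #{v | n ≤ 4 * G.degree v} < h₀ := by
    by_contra! hle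
    have h₃ := (h₂ n (by omega) G hG hle).trans (Nat.mul_le_mul_left _ hcount)
    have : 0 < n ^ (m + 1) := pow_pos hnpos _
    nlinarith
  have hlow := (h₁ n (by omega) G hG).trans (Nat.mul_le_mul_left _ hcount)
  set E : Finset (Fin n × Fin n) :=
    {p | G.Adj p.1 p.2 ∧ 4 * G.degree p.1 < n ∧ 4 * G.degree p.2 < n}
  set H : Finset (Fin n) := {v | n ≤ 4 * G.degree v}
  have hE : #E ≤ D₁ * M * n := by
    refine Nat.le_of_mul_le_mul_right (hlow.trans_eq ?_) (pow_pos hnpos m)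
    ring
  have hsub : G.edgeSet ⊆
      ((E ∪ (H ×ˢ univ ∪ univ ×ˢ H)).image (fun p ↦ s(p.1, p.2)) : Finset _) := by
    intro e he
    induction e with
    | h x y =>
      refine mem_coe.2 (mem_image.2 ⟨(x, y), ?_, rfl⟩)
      have : G.Adj x y := he
      simp only [E, H, mem_union, mem_filter, mem_univ, true_and, mem_product, and_true]
      grind
  calc G.edgeSet.ncard ≤ #(E ∪ (H ×ˢ univ ∪ univ ×ˢ H)) := by
        refine (Set.ncard_le_ncard hsub (finite_toSet _)).trans ?_
        rw [Set.ncard_coe_finset]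
        exact card_image_le
    _ ≤ #E + (#H * n + n * #H) := by
        refine (card_union_le _ _).trans (Nat.add_le_add_left ((card_union_le _ _).trans ?_) _)
        simp
    _ ≤ (D₁ * M + 2 * h₀) * n := by nlinarith

/-- Let `s ≥ 4` and `r` odd with `5 ≤ r ≤ 2s - 4`. For every `f : ℕ → ℝ` with
`f(n) → ∞`, there are `C > 0` and `n₀` such that for all `n ≥ n₀`, every `n`-vertex
`K_s`-saturated graph minimizing the number of copies of `C_r` has at most `C·n·f(n)` edges. -/
theorem edge_bound_odd (s r : ℕ) (hs : 4 ≤ s) (hodd : Odd r) (hr5 : 5 ≤ r)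
    (hr : r ≤ 2 * s - 4) (f : ℕ → ℝ) (hf : Filter.Tendsto f Filter.atTop Filter.atTop) :
    ∃ C : ℝ, 0 < C ∧ ∃ n₀ : ℕ, ∀ n ≥ n₀, ∀ G : SimpleGraph (Fin n), KSat s G →
      (∀ G' : SimpleGraph (Fin n), KSat s G' → cycleCount G r ≤ cycleCount G' r) →
      (G.edgeSet.ncard : ℝ) ≤ C * n * f n := by
  obtain ⟨k, hk⟩ := hodd
  obtain ⟨m, rfl⟩ : ∃ m, k = m + 1 := ⟨k - 1, by omega⟩
  obtain rfl : r = 2 * m + 3 := by omega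
  obtain ⟨C, n₀, h⟩ := exists_ncard_edgeSet_le_mul s m (by omega) (by omega)
  obtain ⟨n₁, hn₁⟩ := Filter.eventually_atTop.1 (hf.eventually_ge_atTop 1)
  refine ⟨C + 1, by positivity, n₀ + n₁, fun n hn G hG hmin ↦ ?_⟩
  calc (G.edgeSet.ncard : ℝ) ≤ (C : ℝ) * n := mod_cast h n (by omega) G hG hmin
    _ ≤ (C + 1) * n * 1 := by nlinarith [Nat.cast_nonneg (α := ℝ) n]
    _ ≤ (C + 1) * n * f n := by
      gcongr
      exact hn₁ n (by omega)
end
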